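/- Let A be an essential hyperplane arrangement in K^ℓ, H ∈ A, 1 ≤ p ≤ ℓ−1, and 0 < k < ℓ−2. Assume that A is locally free along H and that pd_S Ω^p(A) ≤ k. Then pd_{S̄} Ω^i(A^H, m^H) ≤ k for i = p−1 and i = p, where S̄ = S/α_H S and (A^H, m^H) is the Ziegler restriction. -/

import Mathlib

noncomputable section
open Classical MvPolynomial

/-- `pdLE R n M` : the `R`-module `M` has projective dimension at most `n`. -/
def pdLE (R : Type) [CommRing R] : ℕ → (M : Type) → [AddCommGroup M] → [Module R M] → Prop
  | 0, M, _, _ => Module.Projective R M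
  | n + 1, M, _, _ => ∃ (ι : Type) (f : (ι →₀ R) →ₗ[R] M),
      Function.Surjective f ∧ pdLE R n (LinearMap.ker f)

/-- Projective dimension as an element of `ℕ∞`. -/
def pdim (R : Type) [CommRing R] (M : Type) [AddCommGroup M] [Module R M] : ℕ∞ :=
  sInf {n : ℕ∞ | ∃ k : ℕ, pdLE R k M ∧ n = (k : ℕ∞)}

/-- The coordinate ring `S = K[x_1, …, x_ℓ]`. -/
abbrev PS (K : Type) [Field K] (ℓ : ℕ) : Type := MvPolynomial (Fin ℓ) K

/-- The free `S`-module of polynomial differential forms of all degrees, realized as the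
exterior algebra over `S` on the free module `S^ℓ` (with `dx_i` the standard basis). -/
abbrev ExtF (K : Type) [Field K] (ℓ : ℕ) : Type :=
  ExteriorAlgebra (PS K ℓ) (Fin ℓ → PS K ℓ)

variable {K : Type} [Field K] {ℓ : ℕ}

/-- The module `Ω^p_V` of polynomial differential `p`-forms. -/
def formsP (K : Type) [Field K] (ℓ : ℕ) (p : ℕ) : Submodule (PS K ℓ) (ExtF K ℓ) :=
  (LinearMap.range (ExteriorAlgebra.ι (PS K ℓ) :
      (Fin ℓ → PS K ℓ) →ₗ[PS K ℓ] ExtF K ℓ)) ^ p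

/-- The defining linear form `α = ∑ c_i x_i` of the hyperplane with coefficient vector `c`. -/
def linP (c : Fin ℓ → K) : PS K ℓ := ∑ i, MvPolynomial.C (c i) * MvPolynomial.X i

/-- The constant one-form `dα = ∑ c_i dx_i`. -/
def dP (c : Fin ℓ → K) : ExtF K ℓ :=
  ExteriorAlgebra.ι (PS K ℓ) (fun i => MvPolynomial.C (c i))

/-- A central hyperplane arrangement in `K^ℓ`: a finite set of (pairwise non-proportional,
nonzero) coefficient vectors of defining linear forms, each representing the hyperplane
`{x : ∑ c_i x_i = 0}`. -/
structure Arrangement (K : Type) [Field K] (ℓ : ℕ) : Type where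
  hyps : Finset (Fin ℓ → K)
  ne_zero : ∀ c ∈ hyps, c ≠ 0
  nonprop : ∀ c ∈ hyps, ∀ c' ∈ hyps, c ≠ c' → ∀ t : K, c ≠ t • c'

/-- The polynomial model of the module `Ω^p(A,m)` of logarithmic `p`-forms of the
multiarrangement `(A,m)`; it is `Q(A,m)·Ω^p(A,m)`, i.e. the image of `Ω^p(A,m)` under the
degree-shifting isomorphism given by multiplication with `Q(A,m)`, so that
`η = Q(A,m)·ω` ranges over polynomial `p`-forms with `dα_H ∧ η ∈ α_H^{m(H)} Ω^{p+1}_V`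
for all `H ∈ A`. -/
def Omega (A : Arrangement K ℓ) (m : (Fin ℓ → K) → ℕ) (p : ℕ) :
    Submodule (PS K ℓ) (ExtF K ℓ) :=
  formsP K ℓ p ⊓ ⨅ c ∈ A.hyps,
    Submodule.comap (LinearMap.mulLeft (PS K ℓ) (dP c))
      (Submodule.map (LinearMap.lsmul (PS K ℓ) (ExtF K ℓ) (linP c ^ m c))
        (formsP K ℓ (p + 1)))

/-- Tameness of a multiarrangement: `pd_S Ω^p(A,m) ≤ p` for all `0 ≤ p ≤ ℓ`. -/
def TameM (A : Arrangement K ℓ) (m : (Fin ℓ → K) → ℕ) : Prop :=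
  ∀ p : ℕ, p ≤ ℓ → pdLE (PS K ℓ) p (Omega A m p)

/-- Tameness of a simple arrangement (constant multiplicity `1`). -/
def Tame (A : Arrangement K ℓ) : Prop := TameM A (fun _ => 1)

/-- Freeness of a multiarrangement: `Ω^1(A,m)` is a free `S`-module. -/
def FreeM (A : Arrangement K ℓ) (m : (Fin ℓ → K) → ℕ) : Prop :=
  Module.Free (PS K ℓ) (Omega A m 1)

/-- An arrangement is essential when the intersection of its hyperplanes is `{0}`,
equivalently the defining forms span the dual space. -/
def Essential (A : Arrangement K ℓ) : Prop :=
  Submodule.span K (A.hyps : Set (Fin ℓ → K)) = ⊤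

/-- The localization `A_x = {H ∈ A : x ∈ H}` of an arrangement at a point `x`. -/
def locArr (A : Arrangement K ℓ) (x : Fin ℓ → K) : Arrangement K ℓ where
  hyps := A.hyps.filter (fun c => ∑ i, c i * x i = 0)
  ne_zero := fun c hc => A.ne_zero c (Finset.mem_filter.mp hc).1
  nonprop := fun c hc c' hc' =>
    A.nonprop c (Finset.mem_filter.mp hc).1 c' (Finset.mem_filter.mp hc').1

/-- `(A,m)` is locally free along the hyperplane `{x : ∑ (c0)_i x_i = 0}` :
`(A_x, m_x)` is free for every nonzero point `x` of this hyperplane. -/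
def LocallyFreeAlong (A : Arrangement K ℓ) (m : (Fin ℓ → K) → ℕ) (c0 : Fin ℓ → K) : Prop :=
  ∀ x : Fin ℓ → K, x ≠ 0 → (∑ i, c0 i * x i = 0) → FreeM (locArr A x) m

/-- The deletion `A ∖ {H}`. -/
def delArr (A : Arrangement K ℓ) (c0 : Fin ℓ → K) : Arrangement K ℓ where
  hyps := A.hyps.erase c0
  ne_zero := fun c hc => A.ne_zero c (Finset.mem_of_mem_erase hc)
  nonprop := fun c hc c' hc' =>
    A.nonprop c (Finset.mem_of_mem_erase hc) c' (Finset.mem_of_mem_erase hc')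

/-- The coefficient vector of the restriction of the linear form `c` to the hyperplane `H`
along the linear identification `e : K^{ℓ-1} ≃ H`. -/
def restrictForm (e : (Fin (ℓ - 1) → K) →ₗ[K] (Fin ℓ → K)) (c : Fin ℓ → K) :
    Fin (ℓ - 1) → K := fun i => ∑ j, c j * e (Pi.single i 1) j

/-- The linear form on `K^ℓ` with coefficient vector `c`. -/
def dotLin (c : Fin ℓ → K) : (Fin ℓ → K) →ₗ[K] K := ∑ i, c i • LinearMap.proj i

/-- `e` identifies `K^{ℓ-1}` with the hyperplane `ker(α_{c0})`. -/
def IsHypEmbedding (c0 : Fin ℓ → K) (e : (Fin (ℓ - 1) → K) →ₗ[K] (Fin ℓ → K)) : Prop :=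
  Function.Injective e ∧ LinearMap.range e = LinearMap.ker (dotLin c0)

/-- `B` (an arrangement in `K^{ℓ-1}`) represents the restriction `A^H` of `A` to the
hyperplane `H` determined by `c0 ∈ A`, via the identification `e : K^{ℓ-1} ≃ H`:
its hyperplanes are exactly the restrictions to `H` of the hyperplanes of `A ∖ {H}`. -/
def IsRestrictionOf (B : Arrangement K (ℓ - 1)) (A : Arrangement K ℓ) (c0 : Fin ℓ → K)
    (e : (Fin (ℓ - 1) → K) →ₗ[K] (Fin ℓ → K)) : Prop :=
  (∀ c ∈ A.hyps, c ≠ c0 → ∃ c' ∈ B.hyps, ∃ t : K, t ≠ 0 ∧ restrictForm e c = t • c') ∧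
  (∀ c' ∈ B.hyps, ∃ c ∈ A.hyps, c ≠ c0 ∧ ∃ t : K, t ≠ 0 ∧ restrictForm e c = t • c')
/-- The Ziegler multiplicity `m^H` on the restriction: `m^H(X) = #{L ∈ A∖{H} : L ∩ H = X}`. -/
def zieglerMult (A : Arrangement K ℓ) (c0 : Fin ℓ → K)
    (e : (Fin (ℓ - 1) → K) →ₗ[K] (Fin ℓ → K)) (c' : Fin (ℓ - 1) → K) : ℕ :=
  (A.hyps.filter (fun c => c ≠ c0 ∧ ∃ t : K, t ≠ 0 ∧ restrictForm e c = t • c')).card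

/-- The wedge `dx_{i_1} ∧ ⋯ ∧ dx_{i_p}` for a list of indices. -/
def wedgeList (l : List (Fin ℓ)) : ExtF K ℓ :=
  (l.map (fun i => ExteriorAlgebra.ι (PS K ℓ) (Pi.single i (1 : PS K ℓ)))).prod

/-- A polynomial `p`-form is homogeneous of (coefficient) degree `d` if it is a sum of
terms `f · dx_{i_1} ∧ ⋯ ∧ dx_{i_p}` with `f` homogeneous of degree `d`. -/
def IsHomogForm (p d : ℕ) (η : ExtF K ℓ) : Prop :=
  η ∈ AddSubgroup.closure {ξ : ExtF K ℓ | ∃ (f : PS K ℓ) (l : List (Fin ℓ)),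
    f.IsHomogeneous d ∧ l.length = p ∧ ξ = f • wedgeList l}

/-- `|m| = ∑_{H ∈ A} m(H)`. -/
def msum (A : Arrangement K ℓ) (m : (Fin ℓ → K) → ℕ) : ℕ := ∑ c ∈ A.hyps, m c

/-- The multiarrangement `(A,m)` is free with exponents `(d_1, …, d_ℓ)`: the polynomial
model of `Ω^1(A,m)` has a homogeneous basis whose `i`-th member has coefficient degree
`|m| - d_i`. -/
def FreeWithExp (A : Arrangement K ℓ) (m : (Fin ℓ → K) → ℕ) (d : Fin ℓ → ℕ) : Prop :=
  ∃ b : Fin ℓ → ExtF K ℓ,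
    (∀ i, b i ∈ Omega A m 1) ∧
    (∀ i, IsHomogForm 1 (msum A m - d i) (b i)) ∧
    LinearIndependent (PS K ℓ) b ∧
    Omega A m 1 ≤ Submodule.span (PS K ℓ) (Set.range b)

/-- The exponent vector `(d_1, d_2, 0, …, 0)`. -/
def expVec (d1 d2 : ℕ) : Fin ℓ → ℕ := fun i =>
  if (i : ℕ) = 0 then d1 else if (i : ℕ) = 1 then d2 else 0

/-- The localization `A_X` of `A` at the lattice element `X = H ∩ L` corresponding,
via the identification `e` of `H` with `K^{ℓ-1}`, to the hyperplane of `H`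
with coefficient vector `c'`. -/
def locOnRestr (A : Arrangement K ℓ) (e : (Fin (ℓ - 1) → K) →ₗ[K] (Fin ℓ → K))
    (c' : Fin (ℓ - 1) → K) : Arrangement K ℓ where
  hyps := A.hyps.filter (fun c => ∃ t : K, restrictForm e c = t • c')
  ne_zero := fun c hc => A.ne_zero c (Finset.mem_filter.mp hc).1
  nonprop := fun c hc c'' hc'' =>
    A.nonprop c (Finset.mem_filter.mp hc).1 c'' (Finset.mem_filter.mp hc'').1

/-- The multiplicity `m - δ_H`. -/
def mdel (m : (Fin ℓ → K) → ℕ) (c0 : Fin ℓ → K) : (Fin ℓ → K) → ℕ :=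
  fun c => if c = c0 then m c - 1 else m c

/-- `ms` is the Euler multiplicity `m^*` on the restriction `B = A^H` (presented via the
identification `e`): for each `X ∈ A^H` the rank-two localization `(A_X, m_X)` is free
with exponents `(d_1^X, d_2^X, 0, …, 0)` ordered so that `(A_X, m_X - δ_H)` is free with
exponents `(d_1^X - 1, d_2^X, 0, …, 0)`, and `m^*(X) = d_2^X`. -/
def IsEulerMult (A : Arrangement K ℓ) (m : (Fin ℓ → K) → ℕ) (c0 : Fin ℓ → K)
    (e : (Fin (ℓ - 1) → K) →ₗ[K] (Fin ℓ → K)) (B : Arrangement K (ℓ - 1))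
    (ms : (Fin (ℓ - 1) → K) → ℕ) : Prop :=
  ∀ c' ∈ B.hyps, ∃ d1 d2 : ℕ,
    FreeWithExp (locOnRestr A e c') m (expVec d1 d2) ∧
    FreeWithExp (locOnRestr A e c') (mdel m c0) (expVec (d1 - 1) d2) ∧
    ms c' = d2

/-- An arrangement is generic if any `k ≤ ℓ-1` of its hyperplanes intersect in
codimension `k`, i.e. any `≤ ℓ-1` of its defining forms are linearly independent. -/
def GenericArr (A : Arrangement K ℓ) : Prop :=
  ∀ s : Finset (Fin ℓ → K), s ⊆ A.hyps → s.card ≤ ℓ - 1 →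
    LinearIndependent K (fun x : {c // c ∈ s} => (x : Fin ℓ → K))

/-- An arrangement is irreducible if it is not a product of two lower-dimensional
arrangements, i.e. its defining forms cannot be split into two complementary proper
subspaces of the dual space. -/
def IrreducibleArr (A : Arrangement K ℓ) : Prop :=
  ¬ ∃ U1 U2 : Submodule K (Fin ℓ → K), U1 ≠ ⊥ ∧ U2 ≠ ⊥ ∧ U1 ⊓ U2 = ⊥ ∧ U1 ⊔ U2 = ⊤ ∧
      ∀ c ∈ A.hyps, c ∈ U1 ∨ c ∈ U2

/-- The defining polynomial `Q(A,m) = ∏_{H ∈ A} α_H^{m(H)}`. -/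
def Qpoly (A : Arrangement K ℓ) (m : (Fin ℓ → K) → ℕ) : PS K ℓ :=
  ∏ c ∈ A.hyps, linP c ^ m c

open CategoryTheory in
theorem pdLE_iff_hasProjectiveDimensionLE (R : Type) [CommRing R] (k : ℕ) (M : Type)
    [AddCommGroup M] [Module R M] :
    pdLE R k M ↔ HasProjectiveDimensionLE (ModuleCat.of R M) k := by
  induction k generalizing M with
  | zero =>
    rw [← projective_iff_hasProjectiveDimensionLE_zero, ← IsProjective.iff_projective]
    rfl
  | succ k ih =>
    have key : ∀ (ι : Type) (f : (ι →₀ R) →ₗ[R] M), Function.Surjective f →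
        (pdLE R k (LinearMap.ker f) ↔ HasProjectiveDimensionLE (ModuleCat.of R M) (k + 1)) := by
      intro ι f hf
      rw [ih]
      have hS := LinearMap.shortExact_shortComplexKer hf
      have hproj : Projective f.shortComplexKer.X₂ :=
        (IsProjective.iff_projective (R := R) (P := ι →₀ R)).mp inferInstance
      exact (hS.hasProjectiveDimensionLT_X₃_iff k hproj).symm
    constructor
    · rintro ⟨ι, f, hf, h⟩
      exact (key ι f hf).mp h
    · intro h
      exact ⟨M, Finsupp.linearCombination R id, Finsupp.linearCombination_id_surjective R M,
        (key _ _ (Finsupp.linearCombination_id_surjective R M)).mpr h⟩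

open CategoryTheory in
theorem pdLE.of_retract {R : Type} [CommRing R] {k : ℕ} {M N : Type}
    [AddCommGroup M] [Module R M] [AddCommGroup N] [Module R N] (hM : pdLE R k M)
    (i : N →ₗ[R] M) (r : M →ₗ[R] N) (h : ∀ x, r (i x) = x) : pdLE R k N := by
  rw [pdLE_iff_hasProjectiveDimensionLE] at hM ⊢
  refine Retract.hasProjectiveDimensionLT (Y := ModuleCat.of R M)
    ⟨ModuleCat.ofHom i, ModuleCat.ofHom r, ?_⟩ (k + 1)
  ext x
  exact h x

/-- Coefficientwise application of a ring homomorphism to finitely supported functions. -/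
def finsuppMapCoeff {R R' : Type} [CommRing R] [CommRing R'] (φ : R →+* R') (ι : Type) :
    (ι →₀ R) →ₛₗ[φ] (ι →₀ R') where
  toFun := Finsupp.mapRange φ φ.map_zero
  map_add' := Finsupp.mapRange_add (map_add φ)
  map_smul' := fun c x => by ext; simp

theorem linearCombination_finsuppMapCoeff {R R' : Type} [CommRing R] [CommRing R'] {φ : R →+* R'}
    {ι M M' : Type} [AddCommGroup M] [Module R M] [AddCommGroup M'] [Module R' M']
    (π : M →ₛₗ[φ] M') (f : ι → M) (x : ι →₀ R) :
    Finsupp.linearCombination R' (fun i => π (f i)) (finsuppMapCoeff φ ι x) =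
      π (Finsupp.linearCombination R f x) := by
  induction x using Finsupp.induction_linear with
  | zero => simp
  | add x y hx hy => simp only [map_add, hx, hy]
  | single i r =>
    have : finsuppMapCoeff φ ι (Finsupp.single i r) = Finsupp.single i (φ r) :=
      Finsupp.mapRange_single (hf := φ.map_zero)
    rw [this, Finsupp.linearCombination_single, Finsupp.linearCombination_single, map_smulₛₗ]

theorem finsuppMapCoeff_surjective {R R' : Type} [CommRing R] [CommRing R'] {φ : R →+* R'}
    (hφ : Function.Surjective φ) (ι : Type) : Function.Surjective (finsuppMapCoeff φ ι) :=
  Finsupp.mapRange_surjective φ φ.map_zero hφ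

theorem exists_smul_of_finsuppMapCoeff_eq_zero {R R' : Type} [CommRing R] [CommRing R']
    {φ : R →+* R'} {a : R} (hker : ∀ r, φ r = 0 → ∃ s, r = a * s) {ι : Type} (x : ι →₀ R)
    (hx : finsuppMapCoeff φ ι x = 0) : ∃ y : ι →₀ R, x = a • y := by
  have h : ∀ i, ∃ s, x i = a * s ∧ (x i = 0 → s = 0) := by
    intro i
    by_cases hi : x i = 0
    · exact ⟨0, by simp [hi], fun _ => rfl⟩
    · obtain ⟨s, hs⟩ := hker (x i) (DFunLike.congr_fun hx i)
      exact ⟨s, hs, fun h => absurd h hi⟩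
  choose s hs hs0 using h
  refine ⟨Finsupp.onFinset x.support s fun i hi => ?_, ?_⟩
  · rw [Finsupp.mem_support_iff]
    exact fun h => hi (hs0 i h)
  · ext i
    simpa using hs i

theorem Module.Projective.of_semilinear_quotient {R R' : Type} [CommRing R] [CommRing R']
    {φ : R →+* R'} (hφ : Function.Surjective φ) {a : R} (hφa : φ a = 0)
    {M M' : Type} [AddCommGroup M] [Module R M] [AddCommGroup M'] [Module R' M']
    (π : M →ₛₗ[φ] M') (hπ : Function.Surjective π) (hker : ∀ m, π m = 0 → ∃ m', m = a • m')
    [hM : Module.Projective R M] : Module.Projective R' M' := by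
  obtain ⟨s, hs⟩ := Module.projective_def'.mp hM
  let q : M →ₛₗ[φ] (M →₀ R') := (finsuppMapCoeff φ M).comp s
  have hq : ∀ m₁ m₂, π m₁ = π m₂ → q m₁ = q m₂ := by
    intro m₁ m₂ h
    obtain ⟨m', hm'⟩ := hker (m₁ - m₂) (by simp [h])
    rw [← sub_eq_zero, ← map_sub, hm', map_smulₛₗ, hφa, zero_smul]
  let t : M' → (M →₀ R') := fun x => q (Function.surjInv hπ x)
  have ht : ∀ m, t (π m) = q m := fun m => hq _ _ (Function.surjInv_eq hπ _)
  let tl : M' →ₗ[R'] (M →₀ R') :=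
    { toFun := t
      map_add' := fun x y => by
        obtain ⟨x, rfl⟩ := hπ x
        obtain ⟨y, rfl⟩ := hπ y
        rw [← map_add, ht, ht, ht, map_add]
      map_smul' := fun c x => by
        obtain ⟨x, rfl⟩ := hπ x
        obtain ⟨c, rfl⟩ := hφ c
        rw [← map_smulₛₗ, ht, ht, map_smulₛₗ, RingHom.id_apply] }
  refine Module.Projective.of_split tl (Finsupp.linearCombination R' fun m => π m) ?_
  ext x
  obtain ⟨x, rfl⟩ := hπ x
  change Finsupp.linearCombination R' (fun m => π m) (t (π x)) = π x
  rw [ht]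
  change Finsupp.linearCombination R' (fun m => π (id m)) (finsuppMapCoeff φ M (s x)) = π x
  rw [linearCombination_finsuppMapCoeff]
  exact congrArg π (LinearMap.congr_fun hs x)

/-- Projective dimension does not increase modulo an element regular on the ring and module. -/
theorem pdLE.of_semilinear_quotient {R R' : Type} [CommRing R] [IsDomain R] [CommRing R']
    {φ : R →+* R'} (hφ : Function.Surjective φ) {a : R} (ha : a ≠ 0) (hφa : φ a = 0)
    (hφker : ∀ r, φ r = 0 → ∃ s, r = a * s) (k : ℕ)
    {M M' : Type} [AddCommGroup M] [Module R M] [AddCommGroup M'] [Module R' M']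
    (hreg : ∀ m : M, a • m = 0 → m = 0)
    (π : M →ₛₗ[φ] M') (hπ : Function.Surjective π) (hker : ∀ m, π m = 0 → ∃ m', m = a • m')
    (hM : pdLE R k M) : pdLE R' k M' := by
  induction k generalizing M M' with
  | zero =>
    have : Module.Projective R M := hM
    exact Module.Projective.of_semilinear_quotient hφ hφa π hπ hker
  | succ k ih =>
    obtain ⟨ι, f, hf, h⟩ := hM
    let f' : (ι →₀ R') →ₗ[R'] M' :=
      Finsupp.linearCombination R' fun i => π (f (Finsupp.single i 1))
    have hf' : ∀ x, f' (finsuppMapCoeff φ ι x) = π (f x) := by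
      intro x
      rw [linearCombination_finsuppMapCoeff π (fun i => f (Finsupp.single i 1))]
      congr 1
      conv_rhs => rw [← Finsupp.sum_single x]
      rw [Finsupp.linearCombination_apply, Finsupp.sum, Finsupp.sum, map_sum]
      exact Finset.sum_congr rfl fun i _ => by rw [← map_smul]; simp
    refine ⟨ι, f', fun x => ?_, ?_⟩
    · obtain ⟨m, rfl⟩ := hπ x
      obtain ⟨y, rfl⟩ := hf m
      exact ⟨_, hf' y⟩
    let π' : LinearMap.ker f →ₛₗ[φ] LinearMap.ker f' :=
      { toFun := fun x => ⟨finsuppMapCoeff φ ι x, by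
          rw [LinearMap.mem_ker, hf', LinearMap.mem_ker.mp x.2, map_zero]⟩
        map_add' := fun x y => Subtype.ext (map_add (finsuppMapCoeff φ ι) _ _)
        map_smul' := fun c x => Subtype.ext (map_smulₛₗ (finsuppMapCoeff φ ι) c (x : ι →₀ R)) }
    refine ih (M := LinearMap.ker f) (M' := LinearMap.ker f') ?_ π' ?_ ?_ h
    · rintro ⟨x, hx⟩ hax
      have : a • x = 0 := congrArg Subtype.val hax
      exact Subtype.ext ((smul_eq_zero.mp this).resolve_left ha)
    · rintro ⟨x, hx⟩
      obtain ⟨y, rfl⟩ := finsuppMapCoeff_surjective hφ ι x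
      rw [LinearMap.mem_ker, hf'] at hx
      obtain ⟨m, hm⟩ := hker _ hx
      obtain ⟨z, rfl⟩ := hf m
      refine ⟨⟨y - a • z, by rw [LinearMap.mem_ker, map_sub, map_smul, hm, sub_self]⟩, ?_⟩
      apply Subtype.ext
      change finsuppMapCoeff φ ι (y - a • z) = _
      rw [map_sub, map_smulₛₗ, hφa, zero_smul, sub_zero]
    · rintro ⟨x, hx⟩ h0
      obtain ⟨y, rfl⟩ := exists_smul_of_finsuppMapCoeff_eq_zero hφker x (congrArg Subtype.val h0)
      refine ⟨⟨y, ?_⟩, rfl⟩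
      rw [LinearMap.mem_ker, map_smul] at hx
      exact hreg _ hx

/-- Setting the last variable of a polynomial ring to zero. -/
def killLast (K : Type) [Field K] (n : ℕ) : PS K (n + 1) →ₐ[K] PS K n :=
  aeval (Fin.lastCases 0 X)

/-- The inclusion of a polynomial ring into the one with one more variable. -/
def inclCastSucc (K : Type) [Field K] (n : ℕ) : PS K n →ₐ[K] PS K (n + 1) :=
  rename Fin.castSucc

theorem killLast_inclCastSucc (n : ℕ) (r : PS K n) : killLast K n (inclCastSucc K n r) = r := by
  rw [killLast, inclCastSucc, aeval_rename]
  convert aeval_X_left_apply r using 2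
  congr 1
  ext i
  simp

theorem exists_sub_inclCastSucc_killLast (n : ℕ) (r : PS K (n + 1)) :
    ∃ s, r - inclCastSucc K n (killLast K n r) = X (Fin.last n) * s := by
  change X (Fin.last n) ∣ _
  induction r using MvPolynomial.induction_on with
  | C c =>
    rw [← algebraMap_eq, AlgHom.commutes, AlgHom.commutes, sub_self]
    exact dvd_zero _
  | add p q hp hq =>
    convert dvd_add hp hq using 1
    simp only [map_add]
    ring
  | mul_X p i hp =>
    have hi : (X (Fin.last n) : PS K (n + 1)) ∣ X i - inclCastSucc K n (killLast K n (X i)) := by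
      refine Fin.lastCases ?_ (fun j => ?_) i
      · simp [killLast]
      · simp [killLast, inclCastSucc]
    convert dvd_add (hp.mul_right (X i))
      (hi.mul_left (inclCastSucc K n (killLast K n p))) using 1
    simp only [map_mul]
    ring

theorem pdLE_quotient_last {n k : ℕ} {F F' : Type} [AddCommGroup F] [Module (PS K (n + 1)) F]
    [AddCommGroup F'] [Module (PS K n) F'] (π : F →ₛₗ[(killLast K n : PS K (n + 1) →+* PS K n)] F')
    (hreg : ∀ m : F, (X (Fin.last n) : PS K (n + 1)) • m = 0 → m = 0)
    (hπ : Function.Surjective π)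
    (hker : ∀ m, π m = 0 → ∃ m', m = (X (Fin.last n) : PS K (n + 1)) • m')
    (hF : pdLE (PS K (n + 1)) k F) : pdLE (PS K n) k F' := by
  refine pdLE.of_semilinear_quotient (fun r => ⟨inclCastSucc K n r, killLast_inclCastSucc n r⟩)
    (X_ne_zero (Fin.last n)) (by simp [killLast]) ?_ k hreg π hπ hker hF
  intro r hr
  obtain ⟨s, hs⟩ := exists_sub_inclCastSucc_killLast n r
  refine ⟨s, ?_⟩
  have hr' : killLast K n r = 0 := hr
  rwa [hr', map_zero, sub_zero] at hs

theorem mem_of_X_smul_mem_of_depth {k n : ℕ}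
    (hdepth : ∀ (F' : Type) [AddCommGroup F'] [Module (PS K n) F'], pdLE (PS K n) k F' →
      ∀ x : F', (∀ i, (X i : PS K n) • x = 0) → x = 0)
    {G : Type} [AddCommGroup G] [Module (PS K (n + 1)) G]
    (hreg : ∀ m : G, (X (Fin.last n) : PS K (n + 1)) • m = 0 → m = 0)
    (F : Submodule (PS K (n + 1)) G) (hF : pdLE (PS K (n + 1)) k F) (g : G)
    (hg : ∀ i, (X i : PS K (n + 1)) • g ∈ F) : g ∈ F := by
  let y : PS K (n + 1) := X (Fin.last n)
  let P : Submodule (PS K (n + 1)) F := LinearMap.range (LinearMap.lsmul (PS K (n + 1)) F y)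
  let _ : Module (PS K n) (F ⧸ P) := Module.compHom (F ⧸ P) (inclCastSucc K n).toRingHom
  have hsmul : ∀ (c : PS K n) (z : F ⧸ P), c • z = inclCastSucc K n c • z := fun _ _ => rfl
  have hy : ∀ z : F, P.mkQ (y • z) = 0 := fun z => by
    rw [Submodule.mkQ_apply, Submodule.Quotient.mk_eq_zero]
    exact ⟨z, rfl⟩
  let π : F →ₛₗ[(killLast K n : PS K (n + 1) →+* PS K n)] (F ⧸ P) :=
    { toFun := P.mkQ
      map_add' := map_add _
      map_smul' := fun r z => by
        obtain ⟨s, hs⟩ := exists_sub_inclCastSucc_killLast n r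
        have hs' : r = inclCastSucc K n (killLast K n r) + y * s := by rw [← hs]; ring
        change P.mkQ (r • z) = inclCastSucc K n (killLast K n r) • P.mkQ z
        conv_lhs => rw [hs', add_smul, map_add, mul_smul, hy, add_zero, map_smul] }
  have hπ : ∀ z, π z = P.mkQ z := fun _ => rfl
  have hpd : pdLE (PS K n) k (F ⧸ P) := by
    refine pdLE_quotient_last π ?_ P.mkQ_surjective ?_ hF
    · intro m hm
      exact Subtype.ext (hreg _ (congrArg Subtype.val hm))
    · intro m hm
      rw [hπ, Submodule.mkQ_apply, Submodule.Quotient.mk_eq_zero] at hm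
      obtain ⟨m', hm'⟩ := hm
      exact ⟨m', hm'.symm⟩
  have h0 := hdepth (F ⧸ P) hpd (P.mkQ ⟨y • g, hg _⟩) fun i => by
    rw [hsmul, ← map_smul]
    convert hy ⟨X (Fin.castSucc i) • g, hg _⟩ using 2
    apply Subtype.ext
    simp only [inclCastSucc, rename_X, SetLike.mk_smul_mk]
    exact smul_comm _ _ _
  rw [Submodule.mkQ_apply, Submodule.Quotient.mk_eq_zero] at h0
  obtain ⟨f, hf⟩ := h0
  have hf' : y • (f : G) = y • g := congrArg Subtype.val hf
  have : (f : G) - g = 0 := hreg _ (by rw [smul_sub, sub_eq_zero]; exact hf')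
  rw [← sub_eq_zero.mp this]
  exact f.2

/-- A module of projective dimension less than the number of variables has no nonzero element
killed by all variables. -/
theorem eq_zero_of_X_smul_eq_zero (k : ℕ) : ∀ (n : ℕ) (_ : k < n) (F : Type) [AddCommGroup F]
    [Module (PS K n) F], pdLE (PS K n) k F → ∀ x : F, (∀ i, (X i : PS K n) • x = 0) → x = 0 := by
  induction k with
  | zero =>
    intro n hn F _ _ hF x hx
    have : Module.Projective (PS K n) F := hF
    obtain ⟨s, hs⟩ := Module.projective_def'.mp this
    have h0 : s x = 0 := by
      have h := congrArg s (hx ⟨0, hn⟩)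
      rw [map_smul, map_zero] at h
      exact (smul_eq_zero.mp h).resolve_left (X_ne_zero _)
    have := LinearMap.congr_fun hs x
    simpa [h0] using this.symm
  | succ k ih =>
    intro n hn F _ _ hF x hx
    obtain ⟨n, rfl⟩ : ∃ m, n = m + 1 := ⟨n - 1, by omega⟩
    obtain ⟨ι, f, hf, h⟩ := hF
    obtain ⟨g, rfl⟩ := hf x
    refine mem_of_X_smul_mem_of_depth (fun F' _ _ h' => ih n (by omega) F' h')
      (fun m hm => (smul_eq_zero.mp hm).resolve_left (X_ne_zero _)) (LinearMap.ker f) h g fun i => ?_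
    rw [LinearMap.mem_ker, map_smul, hx]

/-- Submodules of small projective dimension are saturated with respect to the maximal ideal
generated by the variables. -/
theorem mem_of_span_X_pow_smul_mem {k n : ℕ} (hk : k + 2 ≤ n) {G : Type} [AddCommGroup G]
    [Module (PS K n) G] (hreg : ∀ (r : PS K n) (m : G), r • m = 0 → r = 0 ∨ m = 0)
    (F : Submodule (PS K n) G) (hF : pdLE (PS K n) k F) (N : ℕ) (g : G)
    (hg : ∀ r ∈ Ideal.span (Set.range (X : Fin n → PS K n)) ^ N, r • g ∈ F) : g ∈ F := by
  obtain ⟨n, rfl⟩ : ∃ m, n = m + 1 := ⟨n - 1, by omega⟩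
  induction N with
  | zero => simpa using hg 1 (by simp)
  | succ N ih =>
    refine ih fun r hr => mem_of_X_smul_mem_of_depth
      (fun F' _ _ h' => eq_zero_of_X_smul_eq_zero k n (by omega) F' h')
      (fun m hm => (hreg _ m hm).resolve_left (X_ne_zero _)) F hF _ fun i => ?_
    rw [smul_smul, mul_comm]
    exact hg _ (by rw [pow_succ]; exact Ideal.mul_mem_mul hr (Ideal.subset_span ⟨i, rfl⟩))

/-- `SDvd r x` : the vector `x` is a multiple of the scalar `r`. -/
def SDvd {R M : Type} [CommRing R] [AddCommGroup M] [Module R M] (r : R) (x : M) : Prop :=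
  ∃ y, x = r • y

section SDvd

variable {R M : Type} [CommRing R] [AddCommGroup M] [Module R M]

theorem SDvd.add {r : R} {x y : M} : SDvd r x → SDvd r y → SDvd r (x + y) := by
  rintro ⟨a, rfl⟩ ⟨b, rfl⟩
  exact ⟨a + b, (smul_add _ _ _).symm⟩

theorem SDvd.neg {r : R} {x : M} : SDvd r x → SDvd r (-x) := by
  rintro ⟨a, rfl⟩
  exact ⟨-a, (smul_neg _ _).symm⟩

theorem SDvd.sub {r : R} {x y : M} (hx : SDvd r x) (hy : SDvd r y) : SDvd r (x - y) := by
  rw [sub_eq_add_neg]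
  exact hx.add hy.neg

theorem SDvd.smul {r : R} {x : M} (s : R) : SDvd r x → SDvd r (s • x) := by
  rintro ⟨a, rfl⟩
  exact ⟨s • a, smul_comm _ _ _⟩

theorem SDvd.smul_of_dvd {r s : R} (h : r ∣ s) (x : M) : SDvd r (s • x) := by
  obtain ⟨t, rfl⟩ := h
  exact ⟨t • x, mul_smul _ _ _⟩

theorem SDvd.map {N : Type} [AddCommGroup N] [Module R N] (f : M →ₗ[R] N) {r : R} {x : M} :
    SDvd r x → SDvd r (f x) := by
  rintro ⟨a, rfl⟩
  exact ⟨f a, map_smul _ _ _⟩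

theorem sDvd_iff_repr {ι : Type} (b : Module.Basis ι R M) (r : R) (x : M) :
    SDvd r x ↔ ∀ i, r ∣ b.repr x i := by
  constructor
  · rintro ⟨y, rfl⟩ i
    simp
  · intro h
    choose g hg using h
    refine ⟨b.repr.symm (Finsupp.onFinset (b.repr x).support
      (fun i => if b.repr x i = 0 then 0 else g i) ?_), ?_⟩
    · intro i hi
      simp only [Finsupp.mem_support_iff]
      intro h0
      simp [h0] at hi
    · apply b.repr.injective
      ext i
      by_cases h0 : b.repr x i = 0
      · simp [h0]
      · simp [h0, ← hg i]

theorem SDvd.of_smul [IsDomain R] [UniqueFactorizationMonoid R] [Module.Free R M] {a r : R}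
    (h : IsRelPrime a r) {x : M} (hx : SDvd a (r • x)) : SDvd a x := by
  let b := Module.Free.chooseBasis R M
  rw [sDvd_iff_repr b] at hx ⊢
  intro i
  have := hx i
  simp only [map_smul, Finsupp.smul_apply, smul_eq_mul] at this
  exact h.dvd_of_dvd_mul_left this

theorem SDvd.prod [IsDomain R] [UniqueFactorizationMonoid R] [Module.Free R M] {ι : Type}
    {s : Finset ι} {f : ι → R} {x : M} (hs : ∀ i ∈ s, ∀ j ∈ s, i ≠ j → IsRelPrime (f i) (f j))
    (hx : ∀ i ∈ s, SDvd (f i) x) : SDvd (∏ i ∈ s, f i) x := by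
  let b := Module.Free.chooseBasis R M
  rw [sDvd_iff_repr b]
  intro j
  apply Finset.prod_dvd_of_isRelPrime
  · intro i hi j hj hij
    exact hs i hi j hj hij
  · intro i hi
    exact (sDvd_iff_repr b _ _).1 (hx i hi) j

end SDvd

section LinearForms

theorem linP_ne_zero {c : Fin ℓ → K} (hc : c ≠ 0) : linP c ≠ 0 := by
  intro h
  apply hc
  ext i
  have := congrArg (MvPolynomial.coeff (Finsupp.single i 1)) h
  simpa [linP, coeff_sum, coeff_C_mul, coeff_X, Finsupp.single_left_inj] using this

theorem linP_add (c c' : Fin ℓ → K) : linP (c + c') = linP c + linP c' := by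
  simp [linP, add_mul, Finset.sum_add_distrib]

theorem linP_smul (t : K) (c : Fin ℓ → K) : linP (t • c) = C t * linP c := by
  simp [linP, Finset.mul_sum, mul_assoc]

theorem isHomogeneous_linP (c : Fin ℓ → K) : (linP c).IsHomogeneous 1 :=
  IsHomogeneous.sum _ _ _ fun _ _ => isHomogeneous_C_mul_X _ _

theorem irreducible_linP {c : Fin ℓ → K} (hc : c ≠ 0) : Irreducible (linP c) := by
  apply irreducible_of_totalDegree_eq_one
  · exact (isHomogeneous_linP c).totalDegree (linP_ne_zero hc)
  · intro x hx
    obtain ⟨i, hi⟩ := Function.ne_iff.1 hc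
    have := hx (Finsupp.single i 1)
    rw [show (linP c).coeff (Finsupp.single i 1) = c i by
      simp [linP, coeff_sum, coeff_C_mul, coeff_X, Finsupp.single_left_inj]] at this
    exact isUnit_of_dvd_unit this (isUnit_iff_ne_zero.2 hi)

theorem coeff_linP (c : Fin ℓ → K) (i : Fin ℓ) :
    (linP c).coeff (Finsupp.single i 1) = c i := by
  simp [linP, coeff_sum, coeff_C_mul, coeff_X, Finsupp.single_left_inj]

theorem isRelPrime_linP {c c' : Fin ℓ → K} (hc : c ≠ 0) (hc' : c' ≠ 0)
    (h : ∀ t : K, c ≠ t • c') : IsRelPrime (linP c) (linP c') := by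
  rw [(irreducible_linP hc).isRelPrime_iff_not_dvd]
  intro hd
  obtain ⟨u, hu⟩ := ((irreducible_linP hc).dvd_irreducible_iff_associated
    (irreducible_linP hc')).1 hd |>.symm
  obtain ⟨t, -, ht⟩ := (MvPolynomial.isUnit_iff_eq_C_of_isReduced).1 u.isUnit
  apply h t
  ext i
  rw [← coeff_linP c, ← hu, ht, mul_comm, coeff_C_mul, coeff_linP]
  rfl

end LinearForms

section Contraction

instance free_extF : Module.Free (PS K ℓ) (ExtF K ℓ) :=
  Module.Free.of_basis (Pi.basisFun (PS K ℓ) (Fin ℓ)).ExteriorAlgebra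

/-- Contraction of polynomial differential forms with a vector field. -/
def ctr (d : Module.Dual (PS K ℓ) (Fin ℓ → PS K ℓ)) : ExtF K ℓ →ₗ[PS K ℓ] ExtF K ℓ :=
  CliffordAlgebra.contractLeft (Q := 0) d

variable (d : Module.Dual (PS K ℓ) (Fin ℓ → PS K ℓ))

theorem ctr_ι_mul (w : Fin ℓ → PS K ℓ) (x : ExtF K ℓ) :
    ctr d (ExteriorAlgebra.ι _ w * x) = d w • x - ExteriorAlgebra.ι _ w * ctr d x :=
  CliffordAlgebra.contractLeft_ι_mul _ _ _

theorem ctr_ctr (x : ExtF K ℓ) : ctr d (ctr d x) = 0 :=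
  CliffordAlgebra.contractLeft_contractLeft _ _

theorem ctr_algebraMap (r : PS K ℓ) : ctr d (algebraMap _ _ r) = 0 :=
  CliffordAlgebra.contractLeft_algebraMap (Q := 0) d r

theorem ctr_ι (w : Fin ℓ → PS K ℓ) :
    ctr d (ExteriorAlgebra.ι _ w) = algebraMap _ _ (d w) := by
  have := ctr_ι_mul d w 1
  rw [← map_one (algebraMap (PS K ℓ) (ExtF K ℓ)), ctr_algebraMap, mul_zero, sub_zero,
    map_one, mul_one] at this
  rw [this, Algebra.algebraMap_eq_smul_one]

theorem ctr_mem_formsP {q : ℕ} {x : ExtF K ℓ} (hx : x ∈ formsP K ℓ (q + 1)) :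
    ctr d x ∈ formsP K ℓ q := by
  induction q generalizing x with
  | zero =>
    simp only [formsP, zero_add, pow_one, LinearMap.mem_range] at hx
    obtain ⟨w, rfl⟩ := hx
    rw [ctr_ι]
    simp only [formsP, pow_zero]
    exact Submodule.algebraMap_mem _
  | succ q ih =>
    rw [formsP, pow_succ'] at hx
    induction hx using Submodule.mul_induction_on' with
    | mem_mul_mem a ha b hb =>
      obtain ⟨w, rfl⟩ := ha
      rw [ctr_ι_mul]
      refine Submodule.sub_mem _ (Submodule.smul_mem _ _ hb) ?_
      rw [formsP, pow_succ']
      exact Submodule.mul_mem_mul ⟨w, rfl⟩ (ih hb)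
    | add a _ b _ ha hb =>
      rw [map_add]
      exact Submodule.add_mem _ ha hb

theorem ctr_formsP_zero {x : ExtF K ℓ} (hx : x ∈ formsP K ℓ 0) : ctr d x = 0 := by
  simp only [formsP, pow_zero] at hx
  obtain ⟨r, rfl⟩ := Submodule.mem_one.1 hx
  exact ctr_algebraMap d r

theorem ι_mul_mem_formsP {q : ℕ} (w : Fin ℓ → PS K ℓ) {x : ExtF K ℓ} (hx : x ∈ formsP K ℓ q) :
    ExteriorAlgebra.ι _ w * x ∈ formsP K ℓ (q + 1) := by
  rw [formsP, pow_succ']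
  exact Submodule.mul_mem_mul ⟨w, rfl⟩ hx

theorem mul_mem_formsP {q r : ℕ} {x y : ExtF K ℓ} (hx : x ∈ formsP K ℓ q)
    (hy : y ∈ formsP K ℓ r) : x * y ∈ formsP K ℓ (q + r) := by
  rw [formsP, pow_add]
  exact Submodule.mul_mem_mul hx hy

theorem mem_formsP_of_smul_mem {q : ℕ} {r : PS K ℓ} (hr : r ≠ 0) {x : ExtF K ℓ}
    (hx : r • x ∈ formsP K ℓ q) : x ∈ formsP K ℓ q := by
  let 𝒜 : ℕ → Submodule (PS K ℓ) (ExtF K ℓ) := fun i => ⋀[PS K ℓ]^i (Fin ℓ → PS K ℓ)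
  have key : ∀ y : ExtF K ℓ, y ∈ formsP K ℓ q ↔
      ∀ i, i ≠ q → (DirectSum.decompose 𝒜 y i : ExtF K ℓ) = 0 := by
    intro y
    constructor
    · intro hy i hi
      exact DirectSum.decompose_of_mem_ne 𝒜 (i := q) hy hi.symm
    · intro h
      have h2 := DirectSum.sum_support_decompose 𝒜 y
      rw [← h2]
      refine Submodule.sum_mem _ fun i _ => ?_
      by_cases hi : i = q
      · subst hi
        exact (DirectSum.decompose 𝒜 y i).2
      · rw [h i hi]
        exact Submodule.zero_mem _
  rw [key] at hx ⊢
  intro i hi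
  have := hx i hi
  rw [DirectSum.decompose_smul, DirectSum.smul_apply, Submodule.coe_smul] at this
  exact (smul_eq_zero.1 this).resolve_left hr

theorem ι_mul_mul_ι (w : Fin ℓ → PS K ℓ) (x : ExtF K ℓ) :
    ExteriorAlgebra.ι _ w * x * ExteriorAlgebra.ι _ w = 0 := by
  induction x using CliffordAlgebra.left_induction with
  | algebraMap r =>
    rw [← Algebra.commutes, mul_assoc]
    erw [ExteriorAlgebra.ι_sq_zero, mul_zero]
  | add x y hx hy =>
    rw [mul_add, add_mul, hx, hy, add_zero]
  | ι_mul x m hx =>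
    have h : ExteriorAlgebra.ι (PS K ℓ) w * ExteriorAlgebra.ι (PS K ℓ) m
        = - (ExteriorAlgebra.ι (PS K ℓ) m * ExteriorAlgebra.ι (PS K ℓ) w) :=
      eq_neg_of_add_eq_zero_left (ExteriorAlgebra.ι_add_mul_swap _ _)
    change ExteriorAlgebra.ι _ w * (ExteriorAlgebra.ι _ m * x) * ExteriorAlgebra.ι _ w = 0
    rw [← mul_assoc, h, neg_mul, neg_mul, mul_assoc, mul_assoc]
    rw [mul_assoc] at hx
    rw [hx, mul_zero, neg_zero]

theorem ι_mul_ι_mul (w : Fin ℓ → PS K ℓ) (x : ExtF K ℓ) :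
    ExteriorAlgebra.ι _ w * (ExteriorAlgebra.ι _ w * x) = 0 := by
  rw [← mul_assoc, ExteriorAlgebra.ι_sq_zero, zero_mul]

theorem mem_Omega_iff {A : Arrangement K ℓ} {m : (Fin ℓ → K) → ℕ} {q : ℕ} {η : ExtF K ℓ} :
    η ∈ Omega A m q ↔
      η ∈ formsP K ℓ q ∧ ∀ c ∈ A.hyps, SDvd (linP c ^ m c) (dP c * η) := by
  simp only [Omega, Submodule.mem_inf, Submodule.mem_iInf, Submodule.mem_comap,
    LinearMap.mulLeft_apply, Submodule.mem_map, LinearMap.lsmul_apply]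
  refine and_congr_right fun hη => forall₂_congr fun c hc => ?_
  constructor
  · rintro ⟨y, -, hy⟩
    exact ⟨y, hy.symm⟩
  · rintro ⟨y, hy⟩
    refine ⟨y, mem_formsP_of_smul_mem (pow_ne_zero (m c) (linP_ne_zero (A.ne_zero c hc))) ?_,
      hy.symm⟩
    rw [← hy]
    exact ι_mul_mem_formsP _ hη

end Contraction

section Pullback

/-- The linear form `c` pulled back along the linear map `e`. -/
def pullC {a b : ℕ} (e : (Fin a → K) →ₗ[K] (Fin b → K)) (c : Fin b → K) : Fin a → K :=
  fun i => ∑ j, c j * e (Pi.single i 1) j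

variable {a b : ℕ} (e : (Fin a → K) →ₗ[K] (Fin b → K))

theorem dotProduct_pullC (c : Fin b → K) (y : Fin a → K) :
    dotProduct (pullC e c) y = dotProduct c (e y) := by
  have hy : y = ∑ i, y i • (Pi.single i 1 : Fin a → K) := by
    simpa using pi_eq_sum_univ' y
  conv_rhs => rw [hy]
  simp only [dotProduct, pullC, map_sum, map_smul, Finset.sum_apply, Pi.smul_apply, smul_eq_mul,
    Finset.sum_mul, Finset.mul_sum]
  rw [Finset.sum_comm]
  refine Finset.sum_congr rfl fun i _ => Finset.sum_congr rfl fun j _ => by ring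

theorem pullC_apply (c : Fin b → K) (i : Fin a) :
    pullC e c i = dotProduct c (e (Pi.single i 1)) := rfl

theorem pullC_add (c c' : Fin b → K) : pullC e (c + c') = pullC e c + pullC e c' := by
  ext i
  simp [pullC_apply]

theorem pullC_smul (t : K) (c : Fin b → K) : pullC e (t • c) = t • pullC e c := by
  ext i
  simp [pullC_apply]

theorem pullC_zero : pullC e (0 : Fin b → K) = 0 := by
  ext i
  simp [pullC_apply]

/-- Pullback of polynomial functions along a linear map. -/
def pullP : PS K b →ₐ[K] PS K a := aeval fun j => linP (pullC e (Pi.single j 1))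

theorem linP_sum {ι : Type} (s : Finset ι) (f : ι → Fin ℓ → K) :
    linP (∑ i ∈ s, f i) = ∑ i ∈ s, linP (f i) := by
  simp only [linP, Finset.sum_apply, map_sum, Finset.sum_mul]
  rw [Finset.sum_comm]

theorem linP_single (i : Fin ℓ) : linP (Pi.single i (1 : K)) = X i := by
  simp [linP, Pi.single_apply, apply_ite C]

theorem pullP_linP (c : Fin b → K) : pullP e (linP c) = linP (pullC e c) := by
  have hc : c = ∑ i, c i • (Pi.single i 1 : Fin b → K) := by
    simpa using pi_eq_sum_univ' c
  have h1 : pullC e c = ∑ i, c i • pullC e (Pi.single i 1) := by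
    let f : (Fin b → K) →ₗ[K] (Fin a → K) :=
      ⟨⟨pullC e, pullC_add e⟩, pullC_smul e⟩
    have h2 : f c = ∑ i, c i • f (Pi.single i 1) := by
      conv_lhs => rw [hc]
      simp
    exact h2
  rw [h1, linP_sum]
  simp only [linP_smul]
  simp [linP, pullP, algHom_C]

/-- Pullback of coefficient vectors of polynomial one-forms along a linear map. -/
def pullV (w : Fin b → PS K b) : Fin a → PS K a :=
  fun i => ∑ j, pullP e (w j) * C (e (Pi.single i 1) j)

theorem pullV_add (w w' : Fin b → PS K b) : pullV e (w + w') = pullV e w + pullV e w' := by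
  ext1 i
  simp [pullV, add_mul, Finset.sum_add_distrib]

theorem pullV_smul (r : PS K b) (w : Fin b → PS K b) :
    pullV e (r • w) = pullP e r • pullV e w := by
  ext1 i
  simp [pullV, Finset.mul_sum, mul_assoc]

theorem pullV_C (c : Fin b → K) : pullV e (fun j => C (c j)) = fun i => C (pullC e c i) := by
  ext1 i
  simp [pullV, pullC, algHom_C]

/-- Pullback of polynomial differential forms along a linear map. -/
def pullF : ExtF K b →+* ExtF K a :=
  letI : Algebra (PS K b) (ExtF K a) :=
    RingHom.toAlgebra' ((algebraMap (PS K a) (ExtF K a)).comp (pullP e).toRingHom)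
      fun r x => Algebra.commutes (pullP e r) x
  (ExteriorAlgebra.lift (PS K b)
    ⟨{ toFun := fun w => ExteriorAlgebra.ι (PS K a) (pullV e w)
       map_add' := fun w w' => by rw [pullV_add, map_add]
       map_smul' := fun r w => by
        rw [pullV_smul, map_smul, RingHom.id_apply, Algebra.smul_def, Algebra.smul_def]
        rfl },
      fun w => ExteriorAlgebra.ι_sq_zero _⟩).toRingHom

theorem pullF_algebraMap (r : PS K b) :
    pullF e (algebraMap _ _ r) = algebraMap _ _ (pullP e r) := by
  let _ : Algebra (PS K b) (ExtF K a) :=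
    RingHom.toAlgebra' ((algebraMap (PS K a) (ExtF K a)).comp (pullP e).toRingHom)
      fun r x => Algebra.commutes (pullP e r) x
  exact AlgHom.commutes (ExteriorAlgebra.lift (PS K b) _) r

theorem pullF_ι (w : Fin b → PS K b) :
    pullF e (ExteriorAlgebra.ι _ w) = ExteriorAlgebra.ι _ (pullV e w) := by
  let _ : Algebra (PS K b) (ExtF K a) :=
    RingHom.toAlgebra' ((algebraMap (PS K a) (ExtF K a)).comp (pullP e).toRingHom)
      fun r x => Algebra.commutes (pullP e r) x
  exact ExteriorAlgebra.lift_ι_apply (PS K b) _ _ w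

theorem pullF_smul (r : PS K b) (x : ExtF K b) : pullF e (r • x) = pullP e r • pullF e x := by
  rw [Algebra.smul_def, map_mul, pullF_algebraMap, ← Algebra.smul_def]

theorem pullF_dP (c : Fin b → K) : pullF e (dP c) = dP (pullC e c) := by
  rw [dP, pullF_ι, pullV_C]
  rfl

theorem pullF_mem_formsP {q : ℕ} {x : ExtF K b} (hx : x ∈ formsP K b q) :
    pullF e x ∈ formsP K a q := by
  induction q generalizing x with
  | zero =>
    simp only [formsP, pow_zero] at hx ⊢
    obtain ⟨r, rfl⟩ := Submodule.mem_one.1 hx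
    rw [pullF_algebraMap]
    exact Submodule.algebraMap_mem _
  | succ q ih =>
    rw [formsP, pow_succ'] at hx
    induction hx using Submodule.mul_induction_on' with
    | mem_mul_mem a ha b hb =>
      obtain ⟨w, rfl⟩ := ha
      rw [map_mul, pullF_ι]
      exact ι_mul_mem_formsP _ (ih hb)
    | add a _ b _ ha hb =>
      rw [map_add]
      exact Submodule.add_mem _ ha hb

end Pullback

theorem exists_mul_ι_eq (w : Fin ℓ → PS K ℓ) (x : ExtF K ℓ) :
    ∃ y, x * ExteriorAlgebra.ι _ w = ExteriorAlgebra.ι _ w * y := by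
  induction x using ExteriorAlgebra.induction with
  | algebraMap r => exact ⟨algebraMap _ _ r, Algebra.commutes _ _⟩
  | ι u => exact ⟨-ExteriorAlgebra.ι _ u, by
      rw [mul_neg]; exact eq_neg_of_add_eq_zero_left (ExteriorAlgebra.ι_add_mul_swap _ _)⟩
  | mul x y hx hy =>
    obtain ⟨x', hx'⟩ := hx
    obtain ⟨y', hy'⟩ := hy
    exact ⟨x' * y', by rw [mul_assoc, hy', ← mul_assoc, hx', mul_assoc]⟩
  | add x y hx hy =>
    obtain ⟨x', hx'⟩ := hx
    obtain ⟨y', hy'⟩ := hy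
    exact ⟨x' + y', by rw [add_mul, hx', hy', mul_add]⟩

/-- `v` is a vector off the hyperplane of `c0`, and `p` is the projection along `v` onto that
hyperplane, which is parametrized by `e`. -/
structure HypSplitting {n : ℕ} (c0 v : Fin ℓ → K) (e : (Fin n → K) →ₗ[K] (Fin ℓ → K))
    (p : (Fin ℓ → K) →ₗ[K] (Fin n → K)) : Prop where
  dot_v : dotProduct c0 v = 1
  proj_emb : ∀ y, p (e y) = y
  emb_proj : ∀ x, e (p x) = x - dotProduct c0 x • v

namespace HypSplitting

variable {n : ℕ} {c0 v : Fin ℓ → K} {e : (Fin n → K) →ₗ[K] (Fin ℓ → K)}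
  {p : (Fin ℓ → K) →ₗ[K] (Fin n → K)} (h : HypSplitting c0 v e p)

include h

theorem v_ne_zero : v ≠ 0 := by
  rintro rfl
  simpa using h.dot_v

theorem c0_ne_zero : c0 ≠ 0 := by
  rintro rfl
  simpa using h.dot_v

theorem dot_emb (y : Fin n → K) : dotProduct c0 (e y) = 0 := by
  have h1 := h.emb_proj (e y)
  rw [h.proj_emb] at h1
  have h2 : dotProduct c0 (e y) • v = 0 := by
    have := sub_eq_self.1 h1.symm
    exact this
  exact (smul_eq_zero.1 h2).resolve_right h.v_ne_zero

theorem pullC_c0 : pullC e c0 = 0 := by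
  ext i
  exact h.dot_emb _

theorem pullC_emb_proj (c : Fin n → K) : pullC e (pullC p c) = c := by
  ext i
  rw [pullC_apply, dotProduct_pullC, h.proj_emb]
  simp

theorem pullC_proj_emb (c : Fin ℓ → K) :
    pullC p (pullC e c) = c - dotProduct c v • c0 := by
  ext i
  rw [pullC_apply, dotProduct_pullC, h.emb_proj]
  simp [dotProduct_sub, mul_comm]

theorem pullP_emb_proj (r : PS K n) : pullP e (pullP p r) = r := by
  have : ((pullP e).comp (pullP p)) = AlgHom.id K _ := by
    ext1 i
    rw [AlgHom.comp_apply, ← linP_single, pullP_linP, pullP_linP, h.pullC_emb_proj]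
    rfl
  exact DFunLike.congr_fun this r

theorem pullP_surjective : Function.Surjective (pullP e) :=
  fun r => ⟨_, h.pullP_emb_proj r⟩

theorem pullP_c0 : pullP e (linP c0) = 0 := by
  rw [pullP_linP, h.pullC_c0]
  simp [linP]

theorem exists_sub_pullP (r : PS K ℓ) :
    ∃ s, r - pullP p (pullP e r) = linP c0 * s := by
  induction r using MvPolynomial.induction_on with
  | C t => exact ⟨0, by simp [algHom_C]⟩
  | add r r' hr hr' =>
    obtain ⟨s, hs⟩ := hr
    obtain ⟨s', hs'⟩ := hr'
    refine ⟨s + s', ?_⟩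
    rw [map_add, map_add, mul_add, ← hs, ← hs']
    ring
  | mul_X r i hr =>
    obtain ⟨s, hs⟩ := hr
    have hX : X i - pullP p (pullP e (X i)) = linP c0 * C (v i) := by
      rw [← linP_single, pullP_linP, pullP_linP, h.pullC_proj_emb]
      have : Pi.single i (1 : K) = (Pi.single i 1 - dotProduct (Pi.single i 1) v • c0)
        + dotProduct (Pi.single i 1) v • c0 := by simp
      conv_lhs => enter [1]; rw [this]
      rw [linP_add, linP_smul]
      simp [mul_comm]
    refine ⟨s * X i + pullP p (pullP e r) * C (v i), ?_⟩
    rw [map_mul, map_mul]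
    linear_combination X i * hs + pullP p (pullP e r) * hX

theorem dvd_of_pullP_eq_zero {r : PS K ℓ} (hr : pullP e r = 0) : ∃ s, r = linP c0 * s := by
  obtain ⟨s, hs⟩ := h.exists_sub_pullP r
  rw [hr, map_zero, sub_zero] at hs
  exact ⟨s, hs⟩

theorem pullV_emb_proj (w : Fin n → PS K n) : pullV e (pullV p w) = w := by
  let f : (Fin n → PS K n) →ₗ[PS K n] (Fin n → PS K n) :=
    { toFun := fun w => pullV e (pullV p w)
      map_add' := fun w w' => by rw [pullV_add, pullV_add]
      map_smul' := fun r w => by rw [pullV_smul, pullV_smul, h.pullP_emb_proj]; rfl }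
  have : f = LinearMap.id := by
    apply LinearMap.pi_ext'
    intro i
    ext1
    have h1 : (Pi.single i 1 : Fin n → PS K n) = fun j => C ((Pi.single i 1 : Fin n → K) j) := by
      ext1 j
      simp [Pi.single_apply, apply_ite C]
    change pullV e (pullV p (Pi.single i 1)) = Pi.single i 1
    rw [h1, pullV_C, pullV_C, h.pullC_emb_proj]
  exact LinearMap.congr_fun this w

theorem exists_sub_pullF (x : ExtF K ℓ) :
    ∃ y z, x - pullF p (pullF e x) = linP c0 • y + dP c0 * z := by
  induction x using ExteriorAlgebra.induction with
  | algebraMap r =>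
    obtain ⟨s, hs⟩ := h.exists_sub_pullP r
    refine ⟨algebraMap _ _ s, 0, ?_⟩
    rw [pullF_algebraMap, pullF_algebraMap, ← map_sub, hs, map_mul, ← Algebra.smul_def, mul_zero,
      add_zero]
  | ι w =>
    have hw : w = ∑ i, w i • (Pi.single i 1 : Fin ℓ → PS K ℓ) := by
      simpa using pi_eq_sum_univ' w
    rw [hw]
    generalize (Finset.univ : Finset (Fin ℓ)) = s
    induction s using Finset.induction_on with
    | empty => exact ⟨0, 0, by simp⟩
    | insert i s his ih =>
      obtain ⟨y, z, hyz⟩ := ih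
      obtain ⟨t, ht⟩ := h.exists_sub_pullP (w i)
      have h1 : (Pi.single i 1 : Fin ℓ → PS K ℓ) = fun j => C ((Pi.single i 1 : Fin ℓ → K) j) := by
        ext1 j
        simp [Pi.single_apply, apply_ite C]
      have h2 : ExteriorAlgebra.ι (PS K ℓ) (Pi.single i 1 : Fin ℓ → PS K ℓ)
          - pullF p (pullF e (ExteriorAlgebra.ι (PS K ℓ) (Pi.single i 1 : Fin ℓ → PS K ℓ)))
          = (C (v i) : PS K ℓ) • dP c0 := by
        rw [h1]
        change dP _ - pullF p (pullF e (dP _)) = _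
        rw [pullF_dP, pullF_dP, h.pullC_proj_emb]
        rw [dP, dP, dP, ← map_sub, ← map_smul]
        congr 1
        ext1 j
        simp
      rw [Finset.sum_insert his]
      rw [map_add, (ExteriorAlgebra.ι (PS K ℓ)).map_smul, map_add (pullF e), map_add (pullF p),
        pullF_smul, pullF_smul]
      set d := ExteriorAlgebra.ι (PS K ℓ) (Pi.single i 1 : Fin ℓ → PS K ℓ) with hd
      refine ⟨y + t • d, z + algebraMap _ _ (pullP p (pullP e (w i)) * C (v i)), ?_⟩
      rw [smul_add, mul_add, ← Algebra.commutes, ← Algebra.smul_def, mul_smul, ← h2, smul_smul,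
        ← ht, sub_smul, smul_sub, add_sub_add_comm, hyz]
      abel
  | mul x y hx hy =>
    obtain ⟨a, b, hab⟩ := hx
    obtain ⟨a', b', hab'⟩ := hy
    obtain ⟨u, hu⟩ := exists_mul_ι_eq (fun i => C (c0 i)) (pullF p (pullF e x))
    refine ⟨a * y + pullF p (pullF e x) * a', b * y + u * b', ?_⟩
    have h1 : x * y - pullF p (pullF e (x * y)) =
        (x - pullF p (pullF e x)) * y +
          pullF p (pullF e x) * (y - pullF p (pullF e y)) := by
      rw [map_mul, map_mul]
      noncomm_ring
    rw [h1, hab, hab', add_mul, mul_add, ← mul_assoc _ (dP c0)]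
    rw [show pullF p (pullF e x) * dP c0 = dP c0 * u from hu]
    simp only [smul_add, smul_mul_assoc, mul_smul_comm, mul_add, mul_assoc]
    abel
  | add x y hx hy =>
    obtain ⟨a, b, hab⟩ := hx
    obtain ⟨a', b', hab'⟩ := hy
    refine ⟨a + a', b + b', ?_⟩
    rw [map_add, map_add, add_sub_add_comm, hab, hab', smul_add, mul_add]
    abel

theorem exists_of_pullF_eq_zero {x : ExtF K ℓ} (hx : pullF e x = 0) :
    ∃ y z, x = linP c0 • y + dP c0 * z := by
  obtain ⟨y, z, hyz⟩ := h.exists_sub_pullF x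
  rw [hx, map_zero, sub_zero] at hyz
  exact ⟨y, z, hyz⟩

end HypSplitting

section Residue

theorem ctr_dP_mul (d : Module.Dual (PS K ℓ) (Fin ℓ → PS K ℓ)) (c : Fin ℓ → K) (x : ExtF K ℓ) :
    ctr d (dP c * x) = d (fun i => C (c i)) • x - dP c * ctr d x :=
  ctr_ι_mul d _ x

theorem dP_mul_dP_mul (c : Fin ℓ → K) (x : ExtF K ℓ) : dP c * (dP c * x) = 0 :=
  ι_mul_ι_mul _ x

theorem dP_mul_comm (c c' : Fin ℓ → K) (x : ExtF K ℓ) :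
    dP c * (dP c' * x) = -(dP c' * (dP c * x)) := by
  have h : dP c * dP c' = -(dP c' * dP c) :=
    eq_neg_of_add_eq_zero_left (ExteriorAlgebra.ι_add_mul_swap _ _)
  rw [← mul_assoc, h, neg_mul, mul_assoc]

/-- Pairing with the vector field with coefficients `u`. -/
def dualOf (u : Fin ℓ → PS K ℓ) : Module.Dual (PS K ℓ) (Fin ℓ → PS K ℓ) :=
  ∑ i, u i • LinearMap.proj i

theorem dualOf_apply (u w : Fin ℓ → PS K ℓ) : dualOf u w = ∑ i, u i * w i := by
  simp [dualOf]

/-- The Euler vector field. -/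
def eulerD (K : Type) [Field K] (ℓ : ℕ) : Module.Dual (PS K ℓ) (Fin ℓ → PS K ℓ) := dualOf X

theorem eulerD_C (c : Fin ℓ → K) : eulerD K ℓ (fun i => C (c i)) = linP c := by
  simp [eulerD, dualOf_apply, linP, mul_comm]

/-- The constant vector field `v`. -/
def constD (v : Fin ℓ → K) : Module.Dual (PS K ℓ) (Fin ℓ → PS K ℓ) := dualOf fun i => C (v i)

theorem constD_C (v c : Fin ℓ → K) : constD v (fun i => C (c i)) = C (dotProduct c v) := by
  simp [constD, dualOf_apply, dotProduct, mul_comm]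

theorem mem_Omega_one_iff {A : Arrangement K ℓ} {q : ℕ} {η : ExtF K ℓ} :
    η ∈ Omega A (fun _ => 1) q ↔
      η ∈ formsP K ℓ q ∧ ∀ c ∈ A.hyps, SDvd (linP c) (dP c * η) := by
  simp only [mem_Omega_iff, pow_one]

variable {A : Arrangement K ℓ} {c0 : Fin ℓ → K} {q : ℕ}

theorem Arrangement.linP_ne_zero (A : Arrangement K ℓ) {c : Fin ℓ → K} (hc : c ∈ A.hyps) :
    linP c ≠ 0 :=
  _root_.linP_ne_zero (A.ne_zero c hc)

theorem Arrangement.isRelPrime (A : Arrangement K ℓ) {c c' : Fin ℓ → K} (hc : c ∈ A.hyps)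
    (hc' : c' ∈ A.hyps) (h : c ≠ c') : IsRelPrime (linP c) (linP c') :=
  isRelPrime_linP (A.ne_zero c hc) (A.ne_zero c' hc') (A.nonprop c hc c' hc' h)

theorem residue_mem_Omega (hc0 : c0 ∈ A.hyps) {η d : ExtF K ℓ}
    (hη : η ∈ Omega A (fun _ => 1) q) (hd : linP c0 • d = dP c0 * η) :
    d ∈ Omega A (fun _ => 1) (q + 1) := by
  rw [mem_Omega_one_iff] at hη ⊢
  refine ⟨mem_formsP_of_smul_mem (A.linP_ne_zero hc0) (hd ▸ ι_mul_mem_formsP _ hη.1), ?_⟩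
  intro c hc
  by_cases h : c = c0
  · subst h
    refine ⟨0, ?_⟩
    rw [smul_zero]
    apply smul_right_injective _ (A.linP_ne_zero hc)
    change linP c • (dP c * d) = linP c • (0 : ExtF K ℓ)
    rw [← mul_smul_comm, hd, dP_mul_dP_mul, smul_zero]
  · apply SDvd.of_smul (A.isRelPrime hc hc0 h)
    rw [← mul_smul_comm, hd, dP_mul_comm]
    obtain ⟨y, hy⟩ := hη.2 c hc
    rw [hy]
    exact ⟨-(dP c0 * y), by rw [mul_smul_comm, smul_neg]⟩

theorem ctr_eulerD_mem_Omega {η : ExtF K ℓ} (hη : η ∈ Omega A (fun _ => 1) (q + 1)) :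
    ctr (eulerD K ℓ) η ∈ Omega A (fun _ => 1) q := by
  rw [mem_Omega_one_iff] at hη ⊢
  refine ⟨ctr_mem_formsP _ hη.1, fun c hc => ?_⟩
  have h := ctr_dP_mul (eulerD K ℓ) c η
  rw [eulerD_C] at h
  rw [show dP c * ctr (eulerD K ℓ) η = linP c • η - ctr (eulerD K ℓ) (dP c * η) by
    rw [h]; abel]
  exact SDvd.sub ⟨η, rfl⟩ ((hη.2 c hc).map _)

/-- The operator `η ↦ (dα / α) ∧ η` on logarithmic forms, where `α` is the form of `c0`. -/
def residue (hc0 : c0 ∈ A.hyps) (q : ℕ) :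
    Omega A (fun _ => 1) q →ₗ[PS K ℓ] Omega A (fun _ => 1) (q + 1) where
  toFun η := ⟨((mem_Omega_one_iff.1 η.2).2 c0 hc0).choose,
    residue_mem_Omega hc0 η.2 ((mem_Omega_one_iff.1 η.2).2 c0 hc0).choose_spec.symm⟩
  map_add' x y := by
    ext1
    apply smul_right_injective _ (A.linP_ne_zero hc0)
    simp only [Submodule.coe_add, smul_add,
      ← ((mem_Omega_one_iff.1 x.2).2 c0 hc0).choose_spec,
      ← ((mem_Omega_one_iff.1 y.2).2 c0 hc0).choose_spec, ← mul_add]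
    exact ((mem_Omega_one_iff.1 (x + y).2).2 c0 hc0).choose_spec.symm
  map_smul' r x := by
    ext1
    apply smul_right_injective _ (A.linP_ne_zero hc0)
    simp only [Submodule.coe_smul, RingHom.id_apply, smul_comm (linP c0) r,
      ← ((mem_Omega_one_iff.1 x.2).2 c0 hc0).choose_spec, ← mul_smul_comm]
    exact ((mem_Omega_one_iff.1 (r • x).2).2 c0 hc0).choose_spec.symm

theorem residue_spec (hc0 : c0 ∈ A.hyps) (η : Omega A (fun _ => 1) q) :
    linP c0 • (residue hc0 q η : ExtF K ℓ) = dP c0 * η :=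
  ((mem_Omega_one_iff.1 η.2).2 c0 hc0).choose_spec.symm

/-- The logarithmic forms killed by contraction with the Euler vector field. -/
def Omega0 (A : Arrangement K ℓ) (q : ℕ) : Submodule (PS K ℓ) (ExtF K ℓ) :=
  Omega A (fun _ => 1) q ⊓ LinearMap.ker (ctr (eulerD K ℓ))

theorem ctr_eulerD_mem_Omega0 {η : ExtF K ℓ} (hη : η ∈ Omega A (fun _ => 1) (q + 1)) :
    ctr (eulerD K ℓ) η ∈ Omega0 A q :=
  ⟨ctr_eulerD_mem_Omega hη, ctr_ctr _ _⟩

theorem ctr_eulerD_eq (hc0 : c0 ∈ A.hyps) {η d : ExtF K ℓ}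
    (hη : ctr (eulerD K ℓ) η = 0) (hd : linP c0 • d = dP c0 * η) :
    ctr (eulerD K ℓ) d = η := by
  apply smul_right_injective _ (A.linP_ne_zero hc0)
  change linP c0 • _ = linP c0 • _
  rw [← map_smul, hd, ctr_dP_mul, eulerD_C, hη, mul_zero, sub_zero]

/-- Contraction with the Euler field as a map of logarithmic forms. -/
def ctrEuler (A : Arrangement K ℓ) (q : ℕ) :
    Omega A (fun _ => 1) (q + 1) →ₗ[PS K ℓ] Omega0 A q :=
  LinearMap.restrict (ctr (eulerD K ℓ)) fun _ hη => ctr_eulerD_mem_Omega0 hη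

theorem pdLE_Omega0 (hc0 : c0 ∈ A.hyps) {k : ℕ}
    (h : pdLE (PS K ℓ) k (Omega A (fun _ => 1) q)) : pdLE (PS K ℓ) k (Omega0 A q) := by
  refine pdLE.of_retract h (Submodule.inclusion inf_le_left) (ctrEuler A q ∘ₗ residue hc0 q) ?_
  intro x
  ext1
  exact ctr_eulerD_eq hc0 x.2.2 (residue_spec hc0 ⟨x, x.2.1⟩)

theorem pdLE_Omega0_of_succ (hc0 : c0 ∈ A.hyps) {k : ℕ}
    (h : pdLE (PS K ℓ) k (Omega A (fun _ => 1) (q + 1))) : pdLE (PS K ℓ) k (Omega0 A q) := by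
  refine pdLE.of_retract h (residue hc0 q ∘ₗ Submodule.inclusion inf_le_left) (ctrEuler A q) ?_
  intro x
  ext1
  exact ctr_eulerD_eq hc0 x.2.2 (residue_spec hc0 ⟨x, x.2.1⟩)

end Residue

section ZieglerResidue

variable {n q : ℕ} {A : Arrangement K ℓ} {c0 v : Fin ℓ → K}
  {e : (Fin n → K) →ₗ[K] (Fin ℓ → K)} {p : (Fin ℓ → K) →ₗ[K] (Fin n → K)}

/-- `y` is the Ziegler residue of `η`: the restriction to the hyperplane of the contraction
of `(dα / α) ∧ η` with `v`, where `α` is the form of `c0`. -/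
def IsZRes (c0 v : Fin ℓ → K) (e : (Fin n → K) →ₗ[K] (Fin ℓ → K)) (η : ExtF K ℓ)
    (y : ExtF K n) : Prop :=
  ∃ d, linP c0 • d = dP c0 * η ∧ y = pullF e (ctr (constD v) d)

theorem IsZRes.add {η ζ : ExtF K ℓ} {y z : ExtF K n} :
    IsZRes c0 v e η y → IsZRes c0 v e ζ z → IsZRes c0 v e (η + ζ) (y + z) := by
  rintro ⟨d, hd, rfl⟩ ⟨d', hd', rfl⟩
  exact ⟨d + d', by rw [smul_add, hd, hd', mul_add], by rw [map_add, map_add]⟩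

theorem IsZRes.smul {η : ExtF K ℓ} {y : ExtF K n} (r : PS K ℓ) :
    IsZRes c0 v e η y → IsZRes c0 v e (r • η) (pullP e r • y) := by
  rintro ⟨d, hd, rfl⟩
  exact ⟨r • d, by rw [smul_comm, hd, mul_smul_comm], by rw [map_smul, pullF_smul]⟩

theorem isZRes_zero : IsZRes c0 v e 0 0 :=
  ⟨0, by simp, by simp⟩

theorem IsZRes.sum {ι : Type} {s : Finset ι} {η : ι → ExtF K ℓ} {y : ι → ExtF K n}
    (h : ∀ i ∈ s, IsZRes c0 v e (η i) (y i)) :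
    IsZRes c0 v e (∑ i ∈ s, η i) (∑ i ∈ s, y i) := by
  induction s using Finset.induction_on with
  | empty => exact isZRes_zero
  | insert i s hi ih =>
    rw [Finset.sum_insert hi, Finset.sum_insert hi]
    exact (h i (Finset.mem_insert_self _ _)).add (ih fun j hj => h j (Finset.mem_insert_of_mem hj))

theorem IsZRes.unique (hc0 : c0 ≠ 0) {η : ExtF K ℓ} {y z : ExtF K n} :
    IsZRes c0 v e η y → IsZRes c0 v e η z → y = z := by
  rintro ⟨d, hd, rfl⟩ ⟨d', hd', rfl⟩
  rw [smul_right_injective _ (linP_ne_zero hc0) (hd.trans hd'.symm)]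

theorem exists_isZRes (hc0 : c0 ∈ A.hyps) {η : ExtF K ℓ} (hη : η ∈ Omega A (fun _ => 1) q) :
    ∃ y, IsZRes c0 v e η y := by
  obtain ⟨d, hd⟩ := (mem_Omega_one_iff.1 hη).2 c0 hc0
  exact ⟨_, d, hd.symm, rfl⟩

theorem dP_mul_residue {c : Fin ℓ → K} (hc : c ≠ 0) {η d : ExtF K ℓ}
    (hd : linP c • d = dP c * η) : dP c * d = 0 := by
  apply smul_right_injective _ (linP_ne_zero hc)
  change linP c • _ = linP c • (0 : ExtF K ℓ)
  rw [← mul_smul_comm, hd, dP_mul_dP_mul, smul_zero]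

theorem ctr_constD_dP_mul {c v : Fin ℓ → K} (hv : dotProduct c v = 1) (x : ExtF K ℓ) :
    ctr (constD v) (dP c * x) = x - dP c * ctr (constD v) x := by
  rw [ctr_dP_mul, constD_C, hv, map_one, one_smul]

theorem residue_eq {c v : Fin ℓ → K} (hc : c ≠ 0) (hv : dotProduct c v = 1) {η d : ExtF K ℓ}
    (hd : linP c • d = dP c * η) : d = dP c * ctr (constD v) d := by
  have h := ctr_constD_dP_mul hv d
  rw [dP_mul_residue hc hd, map_zero] at h
  exact (sub_eq_zero.1 h.symm)

theorem eq_of_residue {c v : Fin ℓ → K} (hv : dotProduct c v = 1) {η d : ExtF K ℓ}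
    (hd : linP c • d = dP c * η) :
    η = dP c * ctr (constD v) η + linP c • ctr (constD v) d := by
  have h := ctr_constD_dP_mul hv η
  rw [← hd, map_smul] at h
  rw [h]
  abel

theorem HypSplitting.pullF_dP_mul (h : HypSplitting c0 v e p) (x : ExtF K ℓ) :
    pullF e (dP c0 * x) = 0 := by
  rw [map_mul, pullF_dP, h.pullC_c0]
  simp [dP, ← Pi.zero_def]

theorem HypSplitting.exists_eq_smul_of_isZRes_zero (h : HypSplitting c0 v e p)
    (hc0 : c0 ∈ A.hyps) {η : ExtF K ℓ} (hη : η ∈ Omega0 A q) (h0 : IsZRes c0 v e η 0) :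
    ∃ η' ∈ Omega0 A q, η = linP c0 • η' := by
  obtain ⟨d, hd, hy⟩ := h0
  obtain ⟨y, z, hyz⟩ := h.exists_of_pullF_eq_zero hy.symm
  have hd2 := residue_eq h.c0_ne_zero h.dot_v hd
  rw [hyz, mul_add, dP_mul_dP_mul, add_zero, mul_smul_comm] at hd2
  have hη2 := ctr_eulerD_eq hc0 hη.2 hd
  rw [hd2, map_smul] at hη2
  refine ⟨_, ⟨?_, ctr_ctr _ _⟩, hη2.symm⟩
  have hη1 := mem_Omega_one_iff.1 hη.1
  refine mem_Omega_one_iff.2 ⟨mem_formsP_of_smul_mem (A.linP_ne_zero hc0) (hη2 ▸ hη1.1), fun c hc => ?_⟩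
  by_cases hcc : c = c0
  · subst hcc
    refine ⟨dP c * y, ?_⟩
    have h1 := ctr_dP_mul (eulerD K ℓ) c (dP c * y)
    rw [dP_mul_dP_mul, map_zero, eulerD_C] at h1
    exact (sub_eq_zero.1 h1.symm).symm
  · apply SDvd.of_smul (A.isRelPrime hc hc0 hcc)
    rw [← mul_smul_comm, hη2]
    exact hη1.2 c hc

/-- The hyperplanes other than `c0` whose restriction is `c'`. -/
def fiber (A : Arrangement K ℓ) (c0 : Fin ℓ → K) (e : (Fin n → K) →ₗ[K] (Fin ℓ → K))
    (c' : Fin n → K) : Finset (Fin ℓ → K) :=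
  A.hyps.filter (fun c => c ≠ c0 ∧ ∃ t : K, t ≠ 0 ∧ pullC e c = t • c')

theorem mem_fiber {c : Fin ℓ → K} {c' : Fin n → K} : c ∈ fiber A c0 e c' ↔
    c ∈ A.hyps ∧ c ≠ c0 ∧ ∃ t : K, t ≠ 0 ∧ pullC e c = t • c' :=
  Finset.mem_filter

theorem associated_pullP_prod_fiber (c' : Fin n → K) :
    Associated (linP c' ^ (fiber A c0 e c').card)
      (pullP e (∏ c ∈ fiber A c0 e c', linP c)) := by
  rw [map_prod, ← Finset.prod_const]
  refine Associated.prod _ _ _ fun c hc => ?_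
  obtain ⟨-, -, t, ht, hct⟩ := mem_fiber.1 hc
  rw [pullP_linP, hct, linP_smul]
  exact associated_unit_mul_right _ _ ((isUnit_iff_ne_zero.2 ht).map C)

theorem HypSplitting.sDvd_prod_fiber {M : Type} [AddCommGroup M] [Module (PS K ℓ) M]
    [Module.Free (PS K ℓ) M] (h : HypSplitting c0 v e p)
    (Λ : (Fin ℓ → PS K ℓ) →ₗ[PS K ℓ] M) (h0 : Λ (fun i => C (c0 i)) = 0)
    (hΛ : ∀ c ∈ A.hyps, SDvd (linP c) (Λ fun i => C (c i))) (c' : Fin n → K) :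
    SDvd (∏ c ∈ fiber A c0 e c', linP c) (Λ fun i => C (pullC p c' i)) := by
  apply SDvd.prod
  · intro c hc c'' hc'' hne
    exact A.isRelPrime (mem_fiber.1 hc).1 (mem_fiber.1 hc'').1 hne
  · intro c hc
    obtain ⟨hcA, -, t, ht, hct⟩ := mem_fiber.1 hc
    have h1 : (fun i => C (pullC p c' i) : Fin ℓ → PS K ℓ) =
        (C t⁻¹ : PS K ℓ) • ((fun i => C (c i)) -
          (C (dotProduct c v) : PS K ℓ) • (fun i => C (c0 i))) := by
      have h2 : pullC p c' = t⁻¹ • (c - dotProduct c v • c0) := by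
        rw [← h.pullC_proj_emb, hct, pullC_smul, smul_smul, inv_mul_cancel₀ ht, one_smul]
      ext1 i
      rw [h2]
      simp
    rw [h1, map_smul, map_sub, map_smul, h0, smul_zero, sub_zero]
    exact (hΛ c hcA).smul _

theorem HypSplitting.proj_v (h : HypSplitting c0 v e p) : p v = 0 := by
  have h1 := h.emb_proj v
  rw [h.dot_v, one_smul, sub_self] at h1
  rw [← h.proj_emb (p v), h1, map_zero]

theorem HypSplitting.isZRes_mem_Omega (h : HypSplitting c0 v e p) (hc0 : c0 ∈ A.hyps)
    (B : Arrangement K n) {η : ExtF K ℓ} (hη : η ∈ Omega A (fun _ => 1) q) {y : ExtF K n}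
    (hy : IsZRes c0 v e η y) : y ∈ Omega B (fun c' => (fiber A c0 e c').card) q := by
  obtain ⟨d, hd, rfl⟩ := hy
  have hdΩ := mem_Omega_one_iff.1 (residue_mem_Omega hc0 hη hd)
  rw [mem_Omega_iff]
  refine ⟨pullF_mem_formsP e (ctr_mem_formsP _ hdΩ.1), fun c' _ => ?_⟩
  obtain ⟨μ, hμ⟩ := h.sDvd_prod_fiber (A := A)
    ((LinearMap.mulRight (PS K ℓ) d).comp (ExteriorAlgebra.ι (PS K ℓ)))
    (dP_mul_residue h.c0_ne_zero hd) (fun c hc => hdΩ.2 c hc) c'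
  change dP (pullC p c') * d = _ at hμ
  have h1 := ctr_dP_mul (constD v) (pullC p c') d
  rw [constD_C, dotProduct_pullC, h.proj_v, dotProduct_zero, map_zero, zero_smul, zero_sub, hμ,
    map_smul] at h1
  have h2 := congrArg (pullF e) h1
  rw [pullF_smul, map_neg, map_mul, pullF_dP, h.pullC_emb_proj] at h2
  rw [← neg_neg (dP c' * _), ← h2]
  exact (SDvd.smul_of_dvd (associated_pullP_prod_fiber c').dvd _).neg

/-- The product of the linear forms of an arrangement. -/
def Qall (A : Arrangement K ℓ) : PS K ℓ := ∏ c ∈ A.hyps, linP c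

/-- The product of the linear forms of an arrangement other than `c0`. -/
def Qdel (A : Arrangement K ℓ) (c0 : Fin ℓ → K) : PS K ℓ := ∏ c ∈ A.hyps.erase c0, linP c

theorem linP_mul_Qdel (hc0 : c0 ∈ A.hyps) : linP c0 * Qdel A c0 = Qall A :=
  Finset.mul_prod_erase _ _ hc0

theorem linP_dvd_Qall (hc0 : c0 ∈ A.hyps) : linP c0 ∣ Qall A :=
  Finset.dvd_prod_of_mem _ hc0

theorem Qall_ne_zero (A : Arrangement K ℓ) : Qall A ≠ 0 :=
  Finset.prod_ne_zero_iff.2 fun _ hc => A.linP_ne_zero hc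

theorem isRelPrime_Qdel (hc0 : c0 ∈ A.hyps) : IsRelPrime (linP c0) (Qdel A c0) := by
  apply IsRelPrime.prod_right
  intro c hc
  exact A.isRelPrime hc0 (Finset.mem_of_mem_erase hc) (Finset.ne_of_mem_erase hc).symm

theorem Qall_smul_mem_Omega {x : ExtF K ℓ} (hx : x ∈ formsP K ℓ q) :
    Qall A • x ∈ Omega A (fun _ => 1) q := by
  rw [mem_Omega_one_iff]
  refine ⟨Submodule.smul_mem _ _ hx, fun c hc => ?_⟩
  rw [mul_smul_comm]
  exact SDvd.smul_of_dvd (linP_dvd_Qall hc) _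

theorem HypSplitting.isZRes_Qall_smul (h : HypSplitting c0 v e p) (hc0 : c0 ∈ A.hyps)
    (x : ExtF K ℓ) :
    IsZRes c0 v e (Qall A • x) (pullP e (Qdel A c0) • pullF e x) := by
  refine ⟨Qdel A c0 • (dP c0 * x), ?_, ?_⟩
  · rw [smul_smul, linP_mul_Qdel hc0, mul_smul_comm]
  · rw [map_smul, pullF_smul, ctr_constD_dP_mul h.dot_v, map_sub, h.pullF_dP_mul, sub_zero]

theorem isZRes_dP_mul (x : ExtF K ℓ) : IsZRes c0 v e (dP c0 * x) 0 :=
  ⟨0, by rw [dP_mul_dP_mul, smul_zero], by simp⟩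

theorem exists_dotProduct_eq_one {c : Fin ℓ → K} (hc : c ≠ 0) : ∃ v, dotProduct c v = 1 := by
  obtain ⟨i, hi⟩ := Function.ne_iff.1 hc
  exact ⟨Pi.single i (c i)⁻¹, by rw [dotProduct_single]; exact mul_inv_cancel₀ hi⟩

theorem dP_mul_mul_of_residue {c v : Fin ℓ → K} (hc : c ≠ 0) (hv : dotProduct c v = 1)
    {η ζ d d' : ExtF K ℓ} (hd : linP c • d = dP c * η) (hd' : linP c • d' = dP c * ζ) :
    dP c * (η * ζ) = (linP c * linP c) •
      (dP c * (ctr (constD v) d * ctr (constD v) d')) := by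
  have h1 := residue_eq hc hv hd
  have h2 := eq_of_residue hv hd'
  rw [← mul_assoc, ← hd]
  generalize ctr (constD v) d = b at *
  generalize ctr (constD v) d' = b' at *
  generalize ctr (constD v) ζ = a' at *
  rw [h1, h2, mul_add, smul_mul_assoc, ← mul_assoc (dP c * b)]
  rw [show dP c * b * dP c = 0 from ι_mul_mul_ι _ _]
  rw [zero_mul, smul_zero, zero_add, mul_smul_comm, smul_mul_assoc, smul_smul,
    mul_assoc]

theorem sDvd_mul_of_residue {c : Fin ℓ → K} (hc : c ≠ 0)
    {η ζ d d' : ExtF K ℓ} (hd : linP c • d = dP c * η) (hd' : linP c • d' = dP c * ζ) :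
    SDvd (linP c) (η * ζ) := by
  obtain ⟨v, hv⟩ := exists_dotProduct_eq_one hc
  have h1 := eq_of_residue hv hd
  have h2 := eq_of_residue hv hd'
  generalize ctr (constD v) d = b at *
  generalize ctr (constD v) d' = b' at *
  generalize ctr (constD v) ζ = a' at *
  generalize ctr (constD v) η = a at *
  rw [h1, h2, add_mul, mul_add, ← mul_assoc (dP c * a)]
  rw [show dP c * a * dP c = 0 from ι_mul_mul_ι _ _]
  rw [zero_mul, zero_add, mul_smul_comm, smul_mul_assoc]
  exact SDvd.add ⟨_, rfl⟩ ⟨_, rfl⟩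

theorem HypSplitting.exists_mul_eq_Qall_smul {r : ℕ} (h : HypSplitting c0 v e p)
    (hc0 : c0 ∈ A.hyps) {η ζ : ExtF K ℓ} (hη : η ∈ Omega A (fun _ => 1) q)
    (hζ : ζ ∈ Omega A (fun _ => 1) r) {y z : ExtF K n} (hy : IsZRes c0 v e η y)
    (hz : IsZRes c0 v e ζ z) :
    ∃ ξ ∈ Omega A (fun _ => 1) (q + r), ∃ w, IsZRes c0 v e ξ w ∧
      y * z = pullP e (Qdel A c0) • w := by
  have hη' := mem_Omega_one_iff.1 hη
  have hζ' := mem_Omega_one_iff.1 hζ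
  obtain ⟨ξ, hξ⟩ : SDvd (Qall A) (η * ζ) := by
    apply SDvd.prod
    · intro c hc c' hc' hne
      exact A.isRelPrime hc hc' hne
    · intro c hc
      obtain ⟨d, hd⟩ := hη'.2 c hc
      obtain ⟨d', hd'⟩ := hζ'.2 c hc
      exact sDvd_mul_of_residue (A.ne_zero c hc) hd.symm hd'.symm
  have key : ∀ (c v : Fin ℓ → K), c ∈ A.hyps → dotProduct c v = 1 → ∀ d d',
      linP c • d = dP c * η → linP c • d' = dP c * ζ →
      Qdel A c • (dP c * ξ) =
        linP c • (dP c * (ctr (constD v) d * ctr (constD v) d')) := by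
    intro c v hc hv d d' hd hd'
    have h1 := dP_mul_mul_of_residue (A.ne_zero c hc) hv hd hd'
    rw [hξ, mul_smul_comm, ← linP_mul_Qdel hc, mul_smul, mul_smul] at h1
    exact smul_right_injective _ (A.linP_ne_zero hc) h1
  have hξΩ : ξ ∈ Omega A (fun _ => 1) (q + r) := by
    rw [mem_Omega_one_iff]
    refine ⟨mem_formsP_of_smul_mem (Qall_ne_zero A) (hξ ▸ mul_mem_formsP hη'.1 hζ'.1),
      fun c hc => ?_⟩
    obtain ⟨v, hv⟩ := exists_dotProduct_eq_one (A.ne_zero c hc)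
    obtain ⟨d, hd⟩ := hη'.2 c hc
    obtain ⟨d', hd'⟩ := hζ'.2 c hc
    exact SDvd.of_smul (isRelPrime_Qdel hc) ⟨_, key c v hc hv d d' hd.symm hd'.symm⟩
  refine ⟨ξ, hξΩ, ?_⟩
  obtain ⟨d, hd, rfl⟩ := hy
  obtain ⟨d', hd', rfl⟩ := hz
  obtain ⟨u, hu⟩ := (mem_Omega_one_iff.1 hξΩ).2 c0 hc0
  refine ⟨_, ⟨u, hu.symm, rfl⟩, ?_⟩
  have h1 := key c0 v hc0 h.dot_v d d' hd hd'
  rw [hu, smul_comm] at h1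
  have h2 := smul_right_injective _ (A.linP_ne_zero hc0) h1
  rw [← pullF_smul, ← map_smul]
  change Qdel A c0 • u = _ at h2
  rw [h2, ctr_constD_dP_mul h.dot_v, map_sub, h.pullF_dP_mul, sub_zero, map_mul]

end ZieglerResidue

section Frames

instance finite_extF : Module.Finite (PS K ℓ) (ExtF K ℓ) :=
  Module.Finite.of_basis (Pi.basisFun (PS K ℓ) (Fin ℓ)).ExteriorAlgebra

theorem mem_formsP_one {x : ExtF K ℓ} :
    x ∈ formsP K ℓ 1 ↔ ∃ w, ExteriorAlgebra.ι (PS K ℓ) w = x := by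
  rw [formsP, pow_one]
  rfl

theorem ι_mem_formsP_one (w : Fin ℓ → PS K ℓ) :
    ExteriorAlgebra.ι (PS K ℓ) w ∈ formsP K ℓ 1 :=
  mem_formsP_one.2 ⟨w, rfl⟩

/-- The product of the linear forms of the hyperplanes which do not contain `x`. -/
def Qaway (A : Arrangement K ℓ) (x : Fin ℓ → K) : PS K ℓ :=
  ∏ c ∈ A.hyps.filter (fun c => ¬ ∑ i, c i * x i = 0), linP c

theorem Qall_locArr_mul_Qaway (A : Arrangement K ℓ) (x : Fin ℓ → K) :
    Qall (locArr A x) * Qaway A x = Qall A :=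
  Finset.prod_filter_mul_prod_filter_not _ _ _

theorem Qdel_smul_dP_mem_Omega {A : Arrangement K ℓ} {c : Fin ℓ → K} :
    Qdel A c • dP c ∈ Omega A (fun _ => 1) 1 := by
  rw [mem_Omega_one_iff]
  refine ⟨Submodule.smul_mem _ _ (ι_mem_formsP_one _), fun c' hc' => ?_⟩
  rw [mul_smul_comm]
  by_cases h : c' = c
  · subst h
    rw [show dP c' * dP c' = 0 from ExteriorAlgebra.ι_sq_zero _, smul_zero]
    exact ⟨0, (smul_zero _).symm⟩
  · exact SDvd.smul_of_dvd (Finset.dvd_prod_of_mem _ (Finset.mem_erase.2 ⟨h, hc'⟩)) _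

theorem exists_frame_of_free {A : Arrangement K ℓ} (h : FreeM A fun _ => 1) :
    ∃ (N : ℕ) (η : Fin N → ExtF K ℓ) (θ : Fin N → Module.Dual (PS K ℓ) (Fin ℓ → PS K ℓ)),
      (∀ i, η i ∈ Omega A (fun _ => 1) 1) ∧
      (∀ i, ∀ c ∈ A.hyps, linP c ∣ θ i fun j => C (c j)) ∧
      ∀ w, ∑ i, θ i w • η i = Qall A • ExteriorAlgebra.ι (PS K ℓ) w := by
  have : Module.Free (PS K ℓ) (Omega A (fun _ => 1) 1) := h
  let b := Module.finBasis (PS K ℓ) (Omega A (fun _ => 1) 1)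
  let Λ : (Fin ℓ → PS K ℓ) →ₗ[PS K ℓ] Omega A (fun _ => 1) 1 :=
    LinearMap.codRestrict _ (Qall A • ExteriorAlgebra.ι (PS K ℓ))
      fun w => Qall_smul_mem_Omega (ι_mem_formsP_one w)
  refine ⟨_, fun i => b i, fun i => b.coord i ∘ₗ Λ, fun i => (b i).2, fun i c hc => ?_,
    fun w => ?_⟩
  · have h1 : Λ (fun j => C (c j)) =
        linP c • (⟨Qdel A c • dP c, Qdel_smul_dP_mem_Omega⟩ : Omega A (fun _ => 1) 1) := by
      ext1
      change Qall A • dP c = linP c • (Qdel A c • dP c)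
      rw [smul_smul, linP_mul_Qdel hc]
    rw [LinearMap.comp_apply, h1, map_smul]
    exact ⟨_, rfl⟩
  · have h1 := congrArg Subtype.val (b.sum_repr (Λ w))
    rw [Submodule.coe_sum] at h1
    exact h1

theorem exists_frame_of_locally_free {A : Arrangement K ℓ} {x : Fin ℓ → K}
    (h : FreeM (locArr A x) fun _ => 1) :
    ∃ (N : ℕ) (η : Fin N → ExtF K ℓ) (θ : Fin N → Module.Dual (PS K ℓ) (Fin ℓ → PS K ℓ)),
      (∀ i, η i ∈ Omega A (fun _ => 1) 1) ∧
      (∀ i, ∀ c ∈ A.hyps, linP c ∣ θ i fun j => C (c j)) ∧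
      ∀ w, ∑ i, θ i w • η i = (Qaway A x * Qall A) • ExteriorAlgebra.ι (PS K ℓ) w := by
  obtain ⟨N, η, θ, hη, hθ, hsum⟩ := exists_frame_of_free h
  have hdvd : ∀ c ∈ A.hyps, c ∉ (locArr A x).hyps → linP c ∣ Qaway A x := fun c hc hcx =>
    Finset.dvd_prod_of_mem _ (Finset.mem_filter.2
      ⟨hc, fun h0 => hcx (Finset.mem_filter.2 ⟨hc, h0⟩)⟩)
  refine ⟨N, fun i => Qaway A x • η i, fun i => Qaway A x • θ i, fun i => ?_, fun i c hc => ?_,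
    fun w => ?_⟩
  · have h1 := mem_Omega_one_iff.1 (hη i)
    rw [mem_Omega_one_iff]
    refine ⟨Submodule.smul_mem _ _ h1.1, fun c hc => ?_⟩
    rw [mul_smul_comm]
    by_cases hcx : c ∈ (locArr A x).hyps
    · exact (h1.2 c hcx).smul _
    · exact SDvd.smul_of_dvd (hdvd c hc hcx) _
  · by_cases hcx : c ∈ (locArr A x).hyps
    · exact Dvd.dvd.mul_left (hθ i c hcx) _
    · exact Dvd.dvd.mul_right (hdvd c hc hcx) _
  · rw [← Qall_locArr_mul_Qaway A x, mul_smul, mul_comm, mul_smul, ← hsum, Finset.smul_sum,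
      Finset.smul_sum]
    refine Finset.sum_congr rfl fun i _ => ?_
    rw [LinearMap.smul_apply, smul_eq_mul, mul_smul, smul_comm (θ i w)]

theorem exists_tangent_frame {A : Arrangement K ℓ} {c0 x : Fin ℓ → K} (hc0 : c0 ∈ A.hyps)
    (h : FreeM (locArr A x) fun _ => 1) :
    ∃ (N : ℕ) (η : Fin N → ExtF K ℓ) (θ : Fin N → Module.Dual (PS K ℓ) (Fin ℓ → PS K ℓ)),
      (∀ i, η i ∈ Omega A (fun _ => 1) 1) ∧
      (∀ i, θ i (fun j => C (c0 j)) = 0) ∧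
      (∀ i, ∀ c ∈ A.hyps, linP c ∣ θ i fun j => C (c j)) ∧
      ∀ w, ∃ g, ∑ i, θ i w • η i =
        (Qaway A x * Qall A) • ExteriorAlgebra.ι (PS K ℓ) w + dP c0 * g := by
  obtain ⟨N, η, θ, hη, hθ, hsum⟩ := exists_frame_of_locally_free h
  choose a ha using fun i => hθ i c0 hc0
  refine ⟨N, η, fun i => θ i - a i • eulerD K ℓ, hη, fun i => ?_, fun i c hc => ?_, fun w => ?_⟩
  · rw [LinearMap.sub_apply, LinearMap.smul_apply, eulerD_C, ha, smul_eq_mul, mul_comm, sub_self]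
  · rw [LinearMap.sub_apply, LinearMap.smul_apply, eulerD_C]
    exact dvd_sub (hθ i c hc) ⟨a i, mul_comm _ _⟩
  · have h1 : ∑ i, a i • η i = (Qaway A x * Qdel A c0) • dP c0 := by
      apply smul_right_injective _ (A.linP_ne_zero hc0)
      change linP c0 • _ = linP c0 • _
      have h2 := hsum fun j => C (c0 j)
      rw [Finset.smul_sum]
      simp only [smul_smul, ← ha, h2]
      rw [← linP_mul_Qdel hc0, mul_left_comm]
      rfl
    refine ⟨-algebraMap _ _ (eulerD K ℓ w * (Qaway A x * Qdel A c0)), ?_⟩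
    simp only [LinearMap.sub_apply, LinearMap.smul_apply, sub_smul, Finset.sum_sub_distrib, hsum]
    rw [mul_neg, ← Algebra.commutes, ← Algebra.smul_def, mul_smul (eulerD K ℓ w), ← h1, Finset.smul_sum,
      ← sub_eq_add_neg]
    congr 1
    refine Finset.sum_congr rfl fun i _ => ?_
    rw [smul_smul, smul_eq_mul, mul_comm]

end Frames

section ExteriorMap

theorem map_add_smulRight (L : (Fin ℓ → PS K ℓ) →ₗ[PS K ℓ] (Fin ℓ → PS K ℓ))
    (θ : Module.Dual (PS K ℓ) (Fin ℓ → PS K ℓ)) (u : Fin ℓ → PS K ℓ) (x : ExtF K ℓ) :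
    ExteriorAlgebra.map (θ.smulRight u + L) x =
      ExteriorAlgebra.map L x + ExteriorAlgebra.ι _ u * ExteriorAlgebra.map L (ctr θ x) := by
  induction x using CliffordAlgebra.left_induction with
  | algebraMap r =>
    have h := ctr_algebraMap θ r
    erw [h]
    rw [map_zero, mul_zero, add_zero]
    erw [AlgHom.commutes, AlgHom.commutes]
  | add x y hx hy =>
    rw [map_add, map_add, map_add, map_add, mul_add, hx, hy]
    abel
  | ι_mul x w hx =>
    change ExteriorAlgebra.map (θ.smulRight u + L) (ExteriorAlgebra.ι _ w * x) =
      ExteriorAlgebra.map L (ExteriorAlgebra.ι _ w * x) + ExteriorAlgebra.ι _ u *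
        ExteriorAlgebra.map L (ctr θ (ExteriorAlgebra.ι _ w * x))
    have h : ExteriorAlgebra.ι (PS K ℓ) (L w) * ExteriorAlgebra.ι (PS K ℓ) u
        = - (ExteriorAlgebra.ι (PS K ℓ) u * ExteriorAlgebra.ι (PS K ℓ) (L w)) :=
      eq_neg_of_add_eq_zero_left (ExteriorAlgebra.ι_add_mul_swap _ _)
    rw [map_mul, hx, ctr_ι_mul, map_mul, map_sub, map_mul, ExteriorAlgebra.map_apply_ι,
      ExteriorAlgebra.map_apply_ι, map_smul, LinearMap.add_apply, LinearMap.smulRight_apply,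
      map_add, map_smul, add_mul, mul_add, mul_add, smul_mul_assoc, smul_mul_assoc, ι_mul_ι_mul,
      smul_zero, add_zero, mul_sub, mul_smul_comm, ← mul_assoc _ (ExteriorAlgebra.ι _ u), h,
      neg_mul, mul_assoc]
    abel

theorem map_zero_formsP {q : ℕ} {x : ExtF K ℓ} (hx : x ∈ formsP K ℓ (q + 1)) :
    ExteriorAlgebra.map (0 : (Fin ℓ → PS K ℓ) →ₗ[PS K ℓ] (Fin ℓ → PS K ℓ)) x = 0 := by
  rw [formsP, pow_succ'] at hx
  induction hx using Submodule.mul_induction_on' with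
  | mem_mul_mem a ha b hb =>
    obtain ⟨w, rfl⟩ := ha
    rw [map_mul, ExteriorAlgebra.map_apply_ι, LinearMap.zero_apply, map_zero, zero_mul]
  | add a _ b _ ha hb => rw [map_add, ha, hb, add_zero]

theorem map_of_ι_eq_smul {q : ℕ} {L : (Fin ℓ → PS K ℓ) →ₗ[PS K ℓ] (Fin ℓ → PS K ℓ)}
    {r : PS K ℓ}
    (hL : ∀ w, ExteriorAlgebra.ι (PS K ℓ) (L w) = r • ExteriorAlgebra.ι (PS K ℓ) w)
    {x : ExtF K ℓ} (hx : x ∈ formsP K ℓ q) : ExteriorAlgebra.map L x = r ^ q • x := by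
  induction q generalizing x with
  | zero =>
    simp only [formsP, pow_zero] at hx
    obtain ⟨s, rfl⟩ := Submodule.mem_one.1 hx
    rw [AlgHom.commutes, pow_zero, one_smul]
  | succ q ih =>
    rw [formsP, pow_succ'] at hx
    induction hx using Submodule.mul_induction_on' with
    | mem_mul_mem a ha b hb =>
      obtain ⟨w, rfl⟩ := ha
      rw [map_mul, ExteriorAlgebra.map_apply_ι, hL, ih hb, smul_mul_smul_comm, pow_succ']
    | add a _ b _ ha hb => rw [map_add, ha, hb, smul_add]

end ExteriorMap

namespace HypSplitting

variable {n : ℕ} {A : Arrangement K ℓ} {c0 v : Fin ℓ → K}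
  {e : (Fin n → K) →ₗ[K] (Fin ℓ → K)} {p : (Fin ℓ → K) →ₗ[K] (Fin n → K)}

/-- The module of Ziegler residues of logarithmic `q`-forms. -/
def zres (h : HypSplitting c0 v e p) (A : Arrangement K ℓ) (q : ℕ) :
    Submodule (PS K n) (ExtF K n) where
  carrier := {y | ∃ η ∈ Omega A (fun _ => 1) q, IsZRes c0 v e η y}
  add_mem' := by
    rintro y z ⟨η, hη, hy⟩ ⟨ζ, hζ, hz⟩
    exact ⟨_, Submodule.add_mem _ hη hζ, hy.add hz⟩
  zero_mem' := ⟨0, Submodule.zero_mem _, isZRes_zero⟩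
  smul_mem' := by
    rintro r y ⟨η, hη, hy⟩
    obtain ⟨s, rfl⟩ := h.pullP_surjective r
    exact ⟨_, Submodule.smul_mem _ s hη, hy.smul s⟩

theorem mem_zres (h : HypSplitting c0 v e p) {q : ℕ} {y : ExtF K n} :
    y ∈ h.zres A q ↔ ∃ η ∈ Omega A (fun _ => 1) q, IsZRes c0 v e η y :=
  Iff.rfl

variable (h : HypSplitting c0 v e p) (hc0 : c0 ∈ A.hyps)

include h hc0

theorem pullC_ne_zero {c : Fin ℓ → K} (hc : c ∈ A.hyps) (hcc : c ≠ c0) : pullC e c ≠ 0 := by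
  intro h0
  have h1 := h.pullC_proj_emb c
  rw [h0, pullC_zero] at h1
  exact A.nonprop c hc c0 hc0 hcc _ (sub_eq_zero.1 h1.symm)

theorem pullP_Qdel_ne_zero : pullP e (Qdel A c0) ≠ 0 := by
  rw [Qdel, map_prod]
  refine Finset.prod_ne_zero_iff.2 fun c hc => ?_
  rw [pullP_linP]
  exact linP_ne_zero (h.pullC_ne_zero hc0 (Finset.mem_of_mem_erase hc) (Finset.ne_of_mem_erase hc))

theorem mul_mem_zres {q : ℕ} {y z : ExtF K n} (hy : y ∈ h.zres A 1) (hz : z ∈ h.zres A q) :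
    ∃ w ∈ h.zres A (q + 1), y * z = pullP e (Qdel A c0) • w := by
  obtain ⟨η, hη, hy⟩ := hy
  obtain ⟨ζ, hζ, hz⟩ := hz
  obtain ⟨ξ, hξ, w, hw, hyz⟩ := h.exists_mul_eq_Qall_smul hc0 hη hζ hy hz
  exact ⟨w, ⟨ξ, add_comm 1 q ▸ hξ, hw⟩, hyz⟩

theorem zres_le_Omega (B : Arrangement K n) (q : ℕ) :
    h.zres A q ≤ Omega B (fun c' => (fiber A c0 e c').card) q := by
  rintro y ⟨η, hη, hy⟩
  exact h.isZRes_mem_Omega hc0 B hη hy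

omit h hc0 in
theorem pullP_Qdel_dvd {B : Arrangement K n}
    (hB : ∀ c ∈ A.hyps, c ≠ c0 → ∃ c' ∈ B.hyps, ∃ t : K, t ≠ 0 ∧ pullC e c = t • c')
    {g : PS K n} (hg : ∀ c' ∈ B.hyps, linP c' ^ (fiber A c0 e c').card ∣ g) :
    pullP e (Qdel A c0) ∣ g := by
  have h1 : ∏ c' ∈ B.hyps, pullP e (∏ c ∈ fiber A c0 e c', linP c) ∣ g := by
    apply Finset.prod_dvd_of_isRelPrime
    · intro c' hc' c'' hc'' hne
      have h2 : IsRelPrime (linP c' ^ (fiber A c0 e c').card)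
          (linP c'' ^ (fiber A c0 e c'').card) :=
        (B.isRelPrime hc' hc'' hne).pow
      exact h2.of_dvd_left (associated_pullP_prod_fiber c').symm.dvd |>.of_dvd_right
        (associated_pullP_prod_fiber c'').symm.dvd
    · intro c' hc'
      exact (associated_pullP_prod_fiber c').symm.dvd.trans (hg c' hc')
  refine dvd_trans ?_ h1
  rw [← map_prod, ← Finset.prod_biUnion]
  · apply map_dvd
    apply Finset.prod_dvd_prod_of_subset
    intro c hc
    obtain ⟨c', hc', ht⟩ := hB c (Finset.mem_of_mem_erase hc) (Finset.ne_of_mem_erase hc)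
    exact Finset.mem_biUnion.2 ⟨c', hc', mem_fiber.2
      ⟨Finset.mem_of_mem_erase hc, Finset.ne_of_mem_erase hc, ht⟩⟩
  · intro c' hc' c'' hc'' hne
    rw [Function.onFun, Finset.disjoint_left]
    intro c h1 h2
    obtain ⟨-, -, t, ht, hct⟩ := mem_fiber.1 h1
    obtain ⟨-, -, s, hs, hcs⟩ := mem_fiber.1 h2
    apply B.nonprop c' hc' c'' hc'' hne (t⁻¹ * s)
    rw [mul_smul, ← hcs, hct, smul_smul, inv_mul_cancel₀ ht, one_smul]

theorem Omega_zero_le_zres {B : Arrangement K n}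
    (hB : ∀ c ∈ A.hyps, c ≠ c0 → ∃ c' ∈ B.hyps, ∃ t : K, t ≠ 0 ∧ pullC e c = t • c') :
    Omega B (fun c' => (fiber A c0 e c').card) 0 ≤ h.zres A 0 := by
  intro x hx
  obtain ⟨hx0, hx⟩ := mem_Omega_iff.1 hx
  simp only [formsP, pow_zero] at hx0
  obtain ⟨g, rfl⟩ := Submodule.mem_one.1 hx0
  have hg : ∀ c' ∈ B.hyps, linP c' ^ (fiber A c0 e c').card ∣ g := by
    intro c' hc'
    obtain ⟨v', hv'⟩ := exists_dotProduct_eq_one (B.ne_zero c' hc')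
    obtain ⟨y, hy⟩ := (hx c' hc').map (ctr (constD v'))
    rw [ctr_constD_dP_mul hv', ctr_algebraMap, mul_zero, sub_zero] at hy
    have h1 := congrArg (ExteriorAlgebra.algebraMapInv (R := PS K n)) hy
    rw [ExteriorAlgebra.algebraMap_leftInverse, map_smul] at h1
    exact ⟨_, h1⟩
  obtain ⟨g', rfl⟩ := pullP_Qdel_dvd hB hg
  obtain ⟨s, rfl⟩ := h.pullP_surjective g'
  refine ⟨Qall A • algebraMap _ _ s,
    Qall_smul_mem_Omega (by rw [formsP, pow_zero]; exact Submodule.algebraMap_mem _), ?_⟩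
  have h1 := h.isZRes_Qall_smul hc0 (algebraMap _ _ s)
  rw [pullF_algebraMap, Algebra.smul_def (pullP e (Qdel A c0)), ← map_mul] at h1
  exact h1

omit h hc0 in
theorem ctr_mem_Omega_restriction {B : Arrangement K n} {q : ℕ}
    {θ : Module.Dual (PS K n) (Fin n → PS K n)}
    (hθ : ∀ c', linP c' ^ (fiber A c0 e c').card ∣ θ fun j => C (c' j)) {x : ExtF K n}
    (hx : x ∈ Omega B (fun c' => (fiber A c0 e c').card) (q + 1)) :
    ctr θ x ∈ Omega B (fun c' => (fiber A c0 e c').card) q := by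
  rw [mem_Omega_iff] at hx ⊢
  refine ⟨ctr_mem_formsP _ hx.1, fun c' hc' => ?_⟩
  have h1 := ctr_dP_mul θ c' x
  rw [show dP c' * ctr θ x = θ (fun j => C (c' j)) • x - ctr θ (dP c' * x) by rw [h1]; abel]
  exact (SDvd.smul_of_dvd (hθ c') _).sub ((hx.2 c' hc').map _)

omit hc0 in
/-- The restriction to the hyperplane of a vector field tangent to it. -/
def restrictDual (θ : Module.Dual (PS K ℓ) (Fin ℓ → PS K ℓ)) :
    Module.Dual (PS K n) (Fin n → PS K n) where
  toFun w := pullP e (θ (pullV p w))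
  map_add' w w' := by rw [pullV_add, map_add, map_add]
  map_smul' r w := by
    rw [pullV_smul, map_smul, smul_eq_mul, map_mul, h.pullP_emb_proj]
    rfl

omit hc0 in
theorem dvd_restrictDual {θ : Module.Dual (PS K ℓ) (Fin ℓ → PS K ℓ)}
    (h0 : θ (fun j => C (c0 j)) = 0) (hθ : ∀ c ∈ A.hyps, linP c ∣ θ fun j => C (c j))
    (c' : Fin n → K) :
    linP c' ^ (fiber A c0 e c').card ∣ h.restrictDual θ fun j => C (c' j) := by
  obtain ⟨y, hy⟩ := h.sDvd_prod_fiber (A := A) θ h0 (fun c hc => hθ c hc) c'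
  change _ ∣ pullP e (θ (pullV p fun j => C (c' j)))
  rw [pullV_C, hy, smul_eq_mul, map_mul]
  exact Dvd.dvd.mul_right (associated_pullP_prod_fiber c').dvd _

/-- Locally at a point `x` of the hyperplane where the arrangement is free, every logarithmic form
of the Ziegler restriction is a residue. -/
theorem pow_smul_mem_zres {B : Arrangement K n}
    (hB : ∀ c ∈ A.hyps, c ≠ c0 → ∃ c' ∈ B.hyps, ∃ t : K, t ≠ 0 ∧ pullC e c = t • c')
    {x : Fin ℓ → K} (hfree : FreeM (locArr A x) fun _ => 1) {q : ℕ} {z : ExtF K n}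
    (hz : z ∈ Omega B (fun c' => (fiber A c0 e c').card) q) :
    pullP e (Qaway A x) ^ q • z ∈ h.zres A q := by
  obtain ⟨N, η, θ, hη, hθ0, hθ, hsum⟩ := exists_tangent_frame hc0 hfree
  choose y hy using fun i => exists_isZRes (e := e) (v := v) hc0 (hη i)
  have hyW : ∀ i, y i ∈ h.zres A 1 := fun i => ⟨η i, hη i, hy i⟩
  choose u hu using fun i => mem_formsP_one.1
    (mem_Omega_iff.1 (h.zres_le_Omega hc0 B 1 (hyW i))).1
  set Q' := pullP e (Qdel A c0) with hQ'
  let θ' := fun i => h.restrictDual (θ i)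
  let L := fun s : Finset (Fin N) => ∑ i ∈ s, (θ' i).smulRight (u i)
  have hL : ∀ w, ExteriorAlgebra.ι (PS K n) (L Finset.univ w) =
      (pullP e (Qaway A x) * Q') • ExteriorAlgebra.ι (PS K n) w := by
    intro w
    obtain ⟨g, hg⟩ := hsum (pullV p w)
    have h1 : IsZRes c0 v e (∑ i, θ i (pullV p w) • η i) (∑ i, θ' i w • y i) :=
      IsZRes.sum fun i _ => (hy i).smul _
    have h2 := ((h.isZRes_Qall_smul hc0 (ExteriorAlgebra.ι _ (pullV p w))).smul
      (Qaway A x)).add (isZRes_dP_mul (v := v) (e := e) (c0 := c0) g)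
    rw [hg, mul_smul] at h1
    have h3 := h1.unique h.c0_ne_zero h2
    rw [pullF_ι, h.pullV_emb_proj, add_zero, smul_smul] at h3
    rw [← h3]
    simp only [L, LinearMap.sum_apply, LinearMap.smulRight_apply, map_sum, map_smul, hu]
  have key : ∀ (s : Finset (Fin N)) (q : ℕ), ∀ z ∈ Omega B (fun c' => (fiber A c0 e c').card) q,
      ∃ w ∈ h.zres A q, ExteriorAlgebra.map (L s) z = Q' ^ q • w := by
    intro s
    induction s using Finset.induction_on with
    | empty =>
      intro q z hz
      have hL0 : L ∅ = 0 := Finset.sum_empty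
      rw [hL0]
      cases q with
      | zero =>
        refine ⟨z, h.Omega_zero_le_zres hc0 hB hz, ?_⟩
        have hz0 := (mem_Omega_iff.1 hz).1
        simp only [formsP, pow_zero] at hz0
        obtain ⟨r, rfl⟩ := Submodule.mem_one.1 hz0
        rw [AlgHom.commutes, pow_zero, one_smul]
      | succ q =>
        exact ⟨0, Submodule.zero_mem _, by
          rw [map_zero_formsP (mem_Omega_iff.1 hz).1, smul_zero]⟩
    | insert i s his ih =>
      intro q z hz
      have hLi : L (insert i s) = (θ' i).smulRight (u i) + L s := Finset.sum_insert his
      rw [hLi, map_add_smulRight]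
      obtain ⟨w, hw, hwz⟩ := ih q z hz
      rw [hwz]
      cases q with
      | zero =>
        rw [ctr_formsP_zero _ (mem_Omega_iff.1 hz).1, map_zero, mul_zero, add_zero]
        exact ⟨w, hw, rfl⟩
      | succ q =>
        obtain ⟨w', hw', hwz'⟩ := ih q _ (ctr_mem_Omega_restriction
          (h.dvd_restrictDual (hθ0 i) (hθ i)) hz)
        obtain ⟨w'', hw'', hyw⟩ := h.mul_mem_zres hc0 (hyW i) hw'
        refine ⟨w + w'', Submodule.add_mem _ hw hw'', ?_⟩
        rw [hwz', hu, mul_smul_comm, hyw, smul_smul, ← pow_succ, smul_add]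
  obtain ⟨w, hw, hwz⟩ := key Finset.univ q z hz
  rw [map_of_ι_eq_smul hL (mem_Omega_iff.1 hz).1, mul_pow, mul_comm, mul_smul] at hwz
  have h1 : pullP e (Qaway A x) ^ q • z = w :=
    smul_right_injective _ (pow_ne_zero q (h.pullP_Qdel_ne_zero hc0)) hwz
  rw [h1]
  exact hw

end HypSplitting

namespace HypSplitting

variable {n : ℕ} {A : Arrangement K ℓ} {c0 v : Fin ℓ → K}
  {e : (Fin n → K) →ₗ[K] (Fin ℓ → K)} {p : (Fin ℓ → K) →ₗ[K] (Fin n → K)}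

/-- The residue along `c0` of the logarithmic forms annihilated by the Euler field. -/
def residue0 (hc0 : c0 ∈ A.hyps) (q : ℕ) : Omega0 A q →ₗ[PS K ℓ] ExtF K ℓ :=
  (Submodule.subtype _).comp ((residue hc0 q).comp (Submodule.inclusion inf_le_left))

theorem residue0_spec (hc0 : c0 ∈ A.hyps) {q : ℕ} (η : Omega0 A q) :
    linP c0 • residue0 hc0 q η = dP c0 * (η : ExtF K ℓ) :=
  residue_spec hc0 _

/-- The Ziegler residue map on the logarithmic forms annihilated by the Euler field. -/
def zresMap (h : HypSplitting c0 v e p) (hc0 : c0 ∈ A.hyps) (q : ℕ) :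
    Omega0 A q →ₛₗ[(pullP e : PS K ℓ →+* PS K n)] h.zres A q where
  toFun η := ⟨pullF e (ctr (constD v) (residue0 hc0 q η)),
    h.mem_zres.2 ⟨η, η.2.1, residue0 hc0 q η, residue0_spec hc0 η, rfl⟩⟩
  map_add' η ζ := Subtype.ext <| by
    change pullF e (ctr (constD v) (residue0 hc0 q (η + ζ))) =
      pullF e (ctr (constD v) (residue0 hc0 q η)) + pullF e (ctr (constD v) (residue0 hc0 q ζ))
    rw [map_add, map_add, map_add]
  map_smul' r η := Subtype.ext <| by
    change pullF e (ctr (constD v) (residue0 hc0 q (r • η))) =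
      pullP e r • pullF e (ctr (constD v) (residue0 hc0 q η))
    rw [map_smul, map_smul, pullF_smul]

theorem isZRes_zresMap (h : HypSplitting c0 v e p) (hc0 : c0 ∈ A.hyps) {q : ℕ}
    (η : Omega0 A q) : IsZRes c0 v e (η : ExtF K ℓ) (h.zresMap hc0 q η : ExtF K n) :=
  ⟨_, residue0_spec hc0 η, rfl⟩

theorem zresMap_surjective (h : HypSplitting c0 v e p) (hc0 : c0 ∈ A.hyps) (q : ℕ) :
    Function.Surjective (h.zresMap hc0 q) := by
  rintro ⟨y, η, hη, d, hd, rfl⟩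
  refine ⟨⟨_, ctr_eulerD_mem_Omega0 (residue_mem_Omega hc0 hη hd)⟩, Subtype.ext ?_⟩
  refine (h.isZRes_zresMap hc0 _).unique h.c0_ne_zero ⟨d, ?_, rfl⟩
  have h1 := ctr_dP_mul (eulerD K ℓ) c0 d
  rw [dP_mul_residue h.c0_ne_zero hd, map_zero, eulerD_C] at h1
  exact sub_eq_zero.1 h1.symm

theorem pdLE_zres (h : HypSplitting c0 v e p) (hc0 : c0 ∈ A.hyps) {q k : ℕ}
    (hpd : pdLE (PS K ℓ) k (Omega0 A q)) : pdLE (PS K n) k (h.zres A q) := by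
  refine pdLE.of_semilinear_quotient (φ := (pullP e : PS K ℓ →+* PS K n)) h.pullP_surjective
    (A.linP_ne_zero hc0) h.pullP_c0 (fun r hr => h.dvd_of_pullP_eq_zero hr) k
    (fun m hm => (smul_eq_zero.1 hm).resolve_left (A.linP_ne_zero hc0))
    (h.zresMap hc0 q) (h.zresMap_surjective hc0 q) (fun η hη => ?_) hpd
  have h1 := h.isZRes_zresMap hc0 η
  rw [hη] at h1
  obtain ⟨η', hη', heq⟩ := h.exists_eq_smul_of_isZRes_zero hc0 η.2 h1
  exact ⟨⟨η', hη'⟩, Subtype.ext heq⟩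

/-- A prime ideal that contains an element of every `pullP e (Qaway A x)`, for `x` a nonzero point
of the hyperplane, contains the irrelevant ideal. -/
theorem X_mem_of_pullP_Qaway_mem (h : HypSplitting c0 v e p) {P : Ideal (PS K n)}
    (hP : P.IsPrime)
    (hmem : ∀ x : Fin ℓ → K, x ≠ 0 → dotProduct c0 x = 0 → pullP e (Qaway A x) ∈ P) (i : Fin n) :
    (X i : PS K n) ∈ P := by
  let W : Submodule K (Fin n → K) :=
    { carrier := {c | linP c ∈ P}
      add_mem' := fun {a b} ha hb => by
        change linP (a + b) ∈ P
        rw [linP_add]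
        exact P.add_mem ha hb
      zero_mem' := by
        change linP 0 ∈ P
        simp [linP]
      smul_mem' := fun t c hc => by
        change linP (t • c) ∈ P
        rw [linP_smul]
        exact P.mul_mem_left _ hc }
  by_cases hW : W = ⊤
  · have h1 : Pi.single i 1 ∈ W := hW ▸ Submodule.mem_top
    rw [← linP_single]
    exact h1
  obtain ⟨f, hf, hWf⟩ := Submodule.exists_le_ker_of_lt_top W (lt_top_iff_ne_top.2 hW)
  have hfx : ∀ c, f c = dotProduct c (fun j => f (Pi.single j 1)) := fun c => by
    rw [LinearMap.pi_apply_eq_sum_univ f c]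
    refine Finset.sum_congr rfl fun j _ => ?_
    congr 2
    ext m
    rw [Pi.single_apply]
    exact if_congr eq_comm rfl rfl
  set x' : Fin n → K := fun j => f (Pi.single j 1)
  have hx' : x' ≠ 0 := fun h0 => hf (LinearMap.ext fun c => by
    rw [hfx, h0, dotProduct_zero, LinearMap.zero_apply])
  have hx : e x' ≠ 0 := fun h0 => hx' (by rw [← h.proj_emb x', h0, map_zero])
  have h1 := hmem (e x') hx (h.dot_emb x')
  rw [Qaway, map_prod] at h1
  obtain ⟨c, hc, hcP⟩ := hP.prod_mem_iff.1 h1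
  rw [pullP_linP] at hcP
  refine absurd ?_ (Finset.mem_filter.1 hc).2
  change dotProduct c (e x') = 0
  rw [← dotProduct_pullC, ← hfx]
  exact hWf hcP

theorem Omega_le_zres (h : HypSplitting c0 v e p) (hc0 : c0 ∈ A.hyps)
    (hlf : LocallyFreeAlong A (fun _ => 1) c0) {B : Arrangement K n}
    (hB : ∀ c ∈ A.hyps, c ≠ c0 → ∃ c' ∈ B.hyps, ∃ t : K, t ≠ 0 ∧ pullC e c = t • c')
    {q k : ℕ} (hk : k + 2 ≤ n) (hpd : pdLE (PS K n) k (h.zres A q)) :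
    Omega B (fun c' => (fiber A c0 e c').card) q ≤ h.zres A q := by
  intro z hz
  let I : Ideal (PS K n) := (h.zres A q).comap (LinearMap.toSpanSingleton (PS K n) (ExtF K n) z)
  have hI : Ideal.span (Set.range X) ≤ I.radical := by
    rw [Ideal.radical_eq_sInf, le_sInf_iff]
    rintro P ⟨hIP, hP⟩
    rw [Ideal.span_le]
    rintro _ ⟨i, rfl⟩
    refine h.X_mem_of_pullP_Qaway_mem (A := A) hP (fun x hx hcx => ?_) i
    exact hP.mem_of_pow_mem q (hIP (h.pow_smul_mem_zres hc0 hB (hlf x hx hcx) hz))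
  obtain ⟨N, hN⟩ := Ideal.exists_pow_le_of_le_radical_of_fg hI
    (Submodule.fg_span (Set.finite_range _))
  exact mem_of_span_X_pow_smul_mem hk (fun r m hrm => smul_eq_zero.1 hrm) _ hpd N z
    fun r hr => hN hr

theorem pdLE_Omega_restriction (h : HypSplitting c0 v e p) (hc0 : c0 ∈ A.hyps)
    (hlf : LocallyFreeAlong A (fun _ => 1) c0) {B : Arrangement K n}
    (hB : ∀ c ∈ A.hyps, c ≠ c0 → ∃ c' ∈ B.hyps, ∃ t : K, t ≠ 0 ∧ pullC e c = t • c')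
    {q k : ℕ} (hk : k + 2 ≤ n) (hpd : pdLE (PS K ℓ) k (Omega0 A q)) :
    pdLE (PS K n) k (Omega B (fun c' => (fiber A c0 e c').card) q) := by
  have h1 := h.pdLE_zres hc0 hpd
  rwa [le_antisymm (h.zres_le_Omega hc0 B q) (h.Omega_le_zres hc0 hlf hB hk h1)] at h1

theorem exists_of_ker_eq {e : (Fin n → K) →ₗ[K] (Fin ℓ → K)} (hc0 : c0 ≠ 0)
    (he : Function.Injective e) (hr : LinearMap.range e = LinearMap.ker (dotLin c0)) :
    ∃ (v : Fin ℓ → K) (p : (Fin ℓ → K) →ₗ[K] (Fin n → K)), HypSplitting c0 v e p := by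
  have hdot : ∀ x, dotLin c0 x = dotProduct c0 x := fun x => by simp [dotLin, dotProduct]
  obtain ⟨v, hv⟩ := exists_dotProduct_eq_one hc0
  obtain ⟨s, hs⟩ := e.exists_leftInverse_of_injective (LinearMap.ker_eq_bot.2 he)
  have hs' : ∀ y, s (e y) = y := fun y => LinearMap.congr_fun hs y
  refine ⟨v, s.comp (LinearMap.id - (dotLin c0).smulRight v), hv, fun y => ?_, fun x => ?_⟩
  · have h1 : dotLin c0 (e y) = 0 := by
      rw [← LinearMap.mem_ker, ← hr]
      exact LinearMap.mem_range_self e y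
    simp [h1, hs']
  · have h1 : x - dotProduct c0 x • v ∈ LinearMap.range e := by
      rw [hr, LinearMap.mem_ker, map_sub, map_smul, hdot, hdot, hv, smul_eq_mul, mul_one, sub_self]
    obtain ⟨y, hy⟩ := h1
    simp only [LinearMap.comp_apply, LinearMap.sub_apply, LinearMap.id_apply,
      LinearMap.smulRight_apply, hdot]
    rw [← hy, hs']

end HypSplitting

/-- If `A` is locally free along `H` and `pd_S Ω^p(A) ≤ k` (with `1 ≤ p ≤ ℓ-1` and
`0 < k < ℓ-2`), then `pd_{S̄} Ω^i(A^H, m^H) ≤ k` for `i = p-1, p`. -/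
theorem pd_ziegler_restriction_le
    {K : Type} [Field K] {ℓ : ℕ} (A : Arrangement K ℓ) (hess : Essential A)
    (c0 : Fin ℓ → K) (hc0 : c0 ∈ A.hyps)
    (p k : ℕ) (hp1 : 1 ≤ p) (hp2 : p ≤ ℓ - 1) (hk1 : 0 < k) (hk2 : k < ℓ - 2)
    (hlf : LocallyFreeAlong A (fun _ => 1) c0)
    (hpd : pdLE (PS K ℓ) k (Omega A (fun _ => 1) p)) :
    ∀ (e : (Fin (ℓ - 1) → K) →ₗ[K] (Fin ℓ → K)) (B : Arrangement K (ℓ - 1)),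
      IsHypEmbedding c0 e → IsRestrictionOf B A c0 e →
        pdLE (PS K (ℓ - 1)) k (Omega B (zieglerMult A c0 e) (p - 1)) ∧
        pdLE (PS K (ℓ - 1)) k (Omega B (zieglerMult A c0 e) p) := by
  intro e B he hB
  obtain ⟨v, s, h⟩ := HypSplitting.exists_of_ker_eq (A.ne_zero c0 hc0) he.1 he.2
  have hk : k + 2 ≤ ℓ - 1 := by omega
  obtain ⟨q, rfl⟩ : ∃ q, p = q + 1 := ⟨p - 1, by omega⟩
  exact ⟨h.pdLE_Omega_restriction hc0 hlf hB.1 hk (pdLE_Omega0_of_succ hc0 hpd),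
    h.pdLE_Omega_restriction hc0 hlf hB.1 hk (pdLE_Omega0 hc0 hpd)⟩
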